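/- arXiv:1705.07493 — 6 statements merged into one kernel-verified Lean document; each statement's English description precedes it below -/
import Mathlib

section
/- If v ∈ ℝ^E and w ∈ ℝ^E are both feasible, then the vector u ∈ ℝ^E defined by u_i = max(v_i, w_i) for every i ∈ E is also feasible. -/
variable {E : Type*}

/-- A vector `w ∈ ℝ^E` is feasible for the link-outflow linear program with capacity `c`,
net inflow `lt` (λ̃), routing coefficients `R`, upstream sets `Ei`, and zero-queue set `I`:
`w i ≤ c i` for every `i`, and `w i ≤ λ̃ i + Σ_{j ∈ E_i} R j i * w j` for every `i ∈ I`. -/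
def Feas [Fintype E] (c lt : E → ℝ) (R : E → E → ℝ) (Ei : E → Finset E)
    (I : Set E) (w : E → ℝ) : Prop :=
  (∀ i, w i ≤ c i) ∧ ∀ i ∈ I, w i ≤ lt i + ∑ j ∈ Ei i, R j i * w j

/-- If `v` and `w` are both feasible, then the componentwise maximum of `v` and `w`
is also feasible. -/
theorem max_feasible [Fintype E] [Nonempty E] (c lt : E → ℝ) (R : E → E → ℝ)
    (Ei : E → Finset E) (I : Set E)
    (hc : ∀ i, 0 ≤ c i) (hlt : ∀ i, 0 ≤ lt i) (hR : ∀ j i, 0 ≤ R j i)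
    (v w : E → ℝ) (hv : Feas c lt R Ei I v) (hw : Feas c lt R Ei I w) :
    Feas c lt R Ei I (fun i => max (v i) (w i)) := by
  refine ⟨fun i => max_le (hv.1 i) (hw.1 i), fun i hi => max_le ?_ ?_⟩
  · refine (hv.2 i hi).trans ?_
    gcongr with j
    · exact hR j i
    · exact le_max_left _ _
  · refine (hw.2 i hi).trans ?_
    gcongr with j
    · exact hR j i
    · exact le_max_right _ _
end

section
/- For every weight vector η ∈ ℝ^E with η_i > 0 for all i ∈ E, there exists exactly one η-optimal vector w ∈ ℝ^E. -/
variable {E : Type*}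

/-- `w` is `η`-optimal: feasible, and it maximizes `Σ_i η_i w_i` over feasible vectors. -/
def Optimal [Fintype E] (c lt : E → ℝ) (R : E → E → ℝ) (Ei : E → Finset E)
    (I : Set E) (η w : E → ℝ) : Prop :=
  Feas c lt R Ei I w ∧ ∀ v, Feas c lt R Ei I v → ∑ i, η i * v i ≤ ∑ i, η i * w i

/-- The zero vector is feasible when capacities and net inflows are nonnegative. -/
theorem feas_zero [Fintype E] {c lt : E → ℝ} (R : E → E → ℝ) (Ei : E → Finset E) (I : Set E)
    (hc : ∀ i, 0 ≤ c i) (hlt : ∀ i, 0 ≤ lt i) : Feas c lt R Ei I 0 :=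
  ⟨hc, fun i _ => by simpa using hlt i⟩

/-- With nonnegative routing coefficients, a nonempty feasible set has a greatest element:
the pointwise supremum of all feasible vectors. -/
theorem exists_isGreatest_feas [Fintype E] {c lt : E → ℝ} {R : E → E → ℝ} {Ei : E → Finset E}
    {I : Set E} (hR : ∀ j i, 0 ≤ R j i) (hne : ∃ v, Feas c lt R Ei I v) :
    ∃ w, IsGreatest {v | Feas c lt R Ei I v} w := by
  have : Nonempty {v // Feas c lt R Ei I v} := nonempty_subtype.2 hne
  have le_sup : ∀ v, Feas c lt R Ei I v → ∀ i, v i ≤ ⨆ u : {v // Feas c lt R Ei I v}, u.1 i :=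
    fun v hv i => le_ciSup (f := fun u : {v // Feas c lt R Ei I v} => u.1 i)
      ⟨c i, by rintro _ ⟨u, rfl⟩; exact u.2.1 i⟩ ⟨v, hv⟩
  refine ⟨fun i => ⨆ u : {v // Feas c lt R Ei I v}, u.1 i, ⟨fun i => ciSup_le fun u => u.2.1 i,
    fun i hi => ciSup_le fun u => (u.2.2 i hi).trans ?_⟩, le_sup⟩
  gcongr with j _
  · exact hR j i
  · exact le_sup u.1 u.2 j

/-- For every strictly positive weight vector `η`, there is exactly one `η`-optimal vector. -/
theorem optimal_exists_unique [Fintype E] [Nonempty E] (c lt : E → ℝ) (R : E → E → ℝ)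
    (Ei : E → Finset E) (I : Set E)
    (hc : ∀ i, 0 ≤ c i) (hlt : ∀ i, 0 ≤ lt i) (hR : ∀ j i, 0 ≤ R j i) :
    ∀ η : E → ℝ, (∀ i, 0 < η i) → ∃! w : E → ℝ, Optimal c lt R Ei I η w := by
  intro η hη
  obtain ⟨w, hw, hmax⟩ := exists_isGreatest_feas hR ⟨0, feas_zero R Ei I hc hlt⟩
  have hle : ∀ v, Feas c lt R Ei I v → ∀ i ∈ Finset.univ, η i * v i ≤ η i * w i :=
    fun v hv i _ => mul_le_mul_of_nonneg_left (hmax hv i) (hη i).le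
  refine ⟨w, ⟨hw, fun v hv => Finset.sum_le_sum (hle v hv)⟩, fun v hv => funext fun i => ?_⟩
  have heq := (Finset.sum_eq_sum_iff_of_le (hle v hv.1)).1
    ((Finset.sum_le_sum (hle v hv.1)).antisymm (hv.2 w hw))
  exact mul_left_cancel₀ (hη i).ne' (heq i (Finset.mem_univ i))
end

section
/- If η and η′ are weight vectors in ℝ^E with strictly positive components, w is η-optimal, and w′ is η′-optimal, then w = w′; that is, the optimal solution of the linear program is independent of the choice of strictly positive weight vector. -/
variable {E : Type*}

/-- The componentwise maximum of two feasible vectors is feasible. -/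
theorem Feas.sup [Fintype E] {c lt : E → ℝ} {R : E → E → ℝ} {Ei : E → Finset E}
    {I : Set E} {v w : E → ℝ} (hR : ∀ j i, 0 ≤ R j i)
    (hv : Feas c lt R Ei I v) (hw : Feas c lt R Ei I w) :
    Feas c lt R Ei I (v ⊔ w) := by
  refine ⟨fun i => sup_le (hv.1 i) (hw.1 i), fun i hi => sup_le ?_ ?_⟩
  · refine (hv.2 i hi).trans ?_
    gcongr with j
    · exact hR j i
    · exact le_sup_left
  · refine (hw.2 i hi).trans ?_
    gcongr with j
    · exact hR j i
    · exact le_sup_right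

/-- An optimal vector dominates every feasible vector componentwise. -/
theorem Optimal.le_of_feas [Fintype E] {c lt : E → ℝ} {R : E → E → ℝ} {Ei : E → Finset E}
    {I : Set E} {η v w : E → ℝ} (hR : ∀ j i, 0 ≤ R j i) (hη : ∀ i, 0 < η i)
    (hw : Optimal c lt R Ei I η w) (hv : Feas c lt R Ei I v) : v ≤ w := by
  intro i
  by_contra! hi
  refine (hw.2 _ (hv.sup hR hw.1)).not_gt (Finset.sum_lt_sum (fun j _ => ?_)
    ⟨i, Finset.mem_univ i, ?_⟩)
  · exact mul_le_mul_of_nonneg_left le_sup_right (hη j).le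
  · exact mul_lt_mul_of_pos_left (hi.trans_le le_sup_left) (hη i)

/-- The optimal solution of the linear program does not depend on the choice of the
strictly positive weight vector. -/
theorem optimal_independent_of_weights [Fintype E] [Nonempty E] (c lt : E → ℝ)
    (R : E → E → ℝ) (Ei : E → Finset E) (I : Set E)
    (hc : ∀ i, 0 ≤ c i) (hlt : ∀ i, 0 ≤ lt i) (hR : ∀ j i, 0 ≤ R j i)
    (η η' w w' : E → ℝ) (hη : ∀ i, 0 < η i) (hη' : ∀ i, 0 < η' i)
    (hw : Optimal c lt R Ei I η w) (hw' : Optimal c lt R Ei I η' w') :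
    w = w' := by
  exact le_antisymm (hw'.le_of_feas hR hη' hw.1) (hw.le_of_feas hR hη hw'.1)
end

section
/- If w ∈ ℝ^E is η-optimal for some weight vector η with strictly positive components, then w_i = c_i for every i ∈ E \ I, and w_i = min(c_i, λ̃_i + Σ_{j ∈ E_i} R_{ji} w_j) for every i ∈ I. -/
variable {E : Type*}

/-- Raising one coordinate of a feasible vector, up to its own upper bounds, keeps it feasible:
the coefficients are nonnegative, so every other bound can only increase. -/
lemma Feas.update [Fintype E] [DecidableEq E] {c lt : E → ℝ} {R : E → E → ℝ}
    {Ei : E → Finset E} {I : Set E} {w : E → ℝ} (hR : ∀ j i, 0 ≤ R j i)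
    (hw : Feas c lt R Ei I w) {i : E} {t : ℝ} (hwt : w i ≤ t) (htc : t ≤ c i)
    (htI : i ∈ I → t ≤ lt i + ∑ j ∈ Ei i, R j i * w j) :
    Feas c lt R Ei I (Function.update w i t) := by
  have hle : w ≤ Function.update w i t := le_update_self_iff.2 hwt
  refine ⟨fun k => ?_, fun k hk => ?_⟩
  · obtain rfl | hki := eq_or_ne k i
    · simpa using htc
    · simpa [hki] using hw.1 k
  · have hsum : ∑ j ∈ Ei k, R j k * w j ≤ ∑ j ∈ Ei k, R j k * Function.update w i t j :=
      Finset.sum_le_sum fun j _ => mul_le_mul_of_nonneg_left (hle j) (hR j k)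
    have hwk : Function.update w i t k ≤ lt k + ∑ j ∈ Ei k, R j k * w j := by
      obtain rfl | hki := eq_or_ne k i
      · simpa using htI hk
      · simpa [hki] using hw.2 k hk
    linarith

/-- Every coordinate of an optimal vector is at least any value allowed by its own upper bounds. -/
lemma Optimal.le_apply [Fintype E] {c lt : E → ℝ} {R : E → E → ℝ}
    {Ei : E → Finset E} {I : Set E} {η w : E → ℝ} (hR : ∀ j i, 0 ≤ R j i)
    (hη : ∀ i, 0 < η i) (hw : Optimal c lt R Ei I η w) {i : E} {t : ℝ} (htc : t ≤ c i)
    (htI : i ∈ I → t ≤ lt i + ∑ j ∈ Ei i, R j i * w j) : t ≤ w i := by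
  classical
  by_contra! hlt
  refine (hw.2 _ (hw.1.update hR hlt.le htc htI)).not_gt ?_
  refine Finset.sum_lt_sum (fun j _ => ?_) ⟨i, Finset.mem_univ i, ?_⟩
  · exact mul_le_mul_of_nonneg_left (le_update_self_iff.2 hlt.le j) (hη j).le
  · simpa using mul_lt_mul_of_pos_left hlt (hη i)

/-- If `w` is `η`-optimal for some strictly positive weight vector `η`, then `w i = c i`
for every `i ∉ I`, and `w i = min (c i) (λ̃ i + Σ_{j ∈ E_i} R j i * w j)` for every `i ∈ I`. -/
theorem optimal_characterization [Fintype E] [Nonempty E] (c lt : E → ℝ)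
    (R : E → E → ℝ) (Ei : E → Finset E) (I : Set E)
    (hc : ∀ i, 0 ≤ c i) (hlt : ∀ i, 0 ≤ lt i) (hR : ∀ j i, 0 ≤ R j i)
    (η w : E → ℝ) (hη : ∀ i, 0 < η i) (hw : Optimal c lt R Ei I η w) :
    (∀ i, i ∉ I → w i = c i) ∧
    (∀ i ∈ I, w i = min (c i) (lt i + ∑ j ∈ Ei i, R j i * w j)) := by
  refine ⟨fun i hi => ?_, fun i hi => ?_⟩
  · exact (hw.1.1 i).antisymm (hw.le_apply hR hη le_rfl fun h => absurd h hi)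
  · exact (le_min (hw.1.1 i) (hw.1.2 i hi)).antisymm
      (hw.le_apply hR hη (min_le_left _ _) fun _ => min_le_right _ _)
end

section
/- Assume the routing matrix R satisfies the connectivity assumption, λ and c are locally piecewise constant, the initial condition satisfies x(0) ∈ [0,∞)^E, the initial history z restricted to [−δ̄, 0) is piecewise constant with values in [0,∞)^E, and commensurability holds. Then there exists exactly one solution (x, z) of the traffic flow model with this initial condition and initial history: the restriction of x to [0,∞) and the restriction of z to [0,∞) are uniquely determined, and they satisfy x_i(t) ≥ 0 and z_i(t) ≥ 0 for all i ∈ E and t ≥ 0. -/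
open MeasureTheory

variable {E : Type*}

/-- `f` is piecewise constant on the set `s`: there is a finite set `D` of breakpoints
such that `f` is constant between consecutive breakpoints (pieces are right-open). -/
def PwcOn (f : ℝ → ℝ) (s : Set ℝ) : Prop :=
  ∃ D : Finset ℝ, ∀ u ∈ s, ∀ v ∈ s, u ≤ v → (∀ d ∈ D, d ∉ Set.Ioc u v) → f u = f v

/-- `f` is locally piecewise constant on `s`: piecewise constant on every compact
subinterval of `s`. -/
def LocPwcOn (f : ℝ → ℝ) (s : Set ℝ) : Prop :=
  ∀ a b : ℝ, PwcOn f (s ∩ Set.Icc a b)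

/-- The maximum `δ̄` of the inter-link travel times over pairs `(j, i)` with `R j i > 0`
(and `0` if there are no such pairs). -/
noncomputable def dbar (R δ : E → E → ℝ) : ℝ :=
  sSup (insert 0 {d : ℝ | ∃ j i, 0 < R j i ∧ δ j i = d})

/-- `w ∈ ℝ^E` is feasible at time `t` for the traffic flow model:
`w i ≤ c t i` for every link `i`, and for every link `i` with empty queue (`x t i = 0`),
`w i ≤ λ̃_i(t) + Σ_{j ∈ E_i} R j i * w j`, where `E_i = {j : R j i > 0 ∧ δ j i = 0}` and
`λ̃_i(t) = λ_i(t) + Σ_{j ∉ E_i} R j i * z (t - δ j i) j`. -/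
def FeasibleAt (R δ : E → E → ℝ) (lam c : ℝ → E → ℝ) (x z : ℝ → E → ℝ)
    (t : ℝ) (w : E → ℝ) [Fintype E] : Prop :=
  (∀ i, w i ≤ c t i) ∧
  ∀ i, x t i = 0 →
    w i ≤ lam t i + ∑ j, R j i * (if δ j i = 0 then w j else z (t - δ j i) j)

/-- `(x, z)` is a solution of the traffic flow model with routing matrix `R`, travel
times `δ`, external inflow `lam` and capacity `c`: queue lengths and outflows are
nonnegative, `z` is locally integrable on `[-δ̄, ∞)`, at every time `t ≥ 0` the outflow
`z t` is feasible and maximizes the cumulative outflow `Σ_i w i` among feasible vectors,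
and the queue lengths satisfy the integral mass-balance equation. -/
def IsSolution [Fintype E] (R δ : E → E → ℝ) (lam c : ℝ → E → ℝ)
    (x z : ℝ → E → ℝ) : Prop :=
  (∀ t, 0 ≤ t → ∀ i, 0 ≤ x t i) ∧
  (∀ t, -(dbar R δ) ≤ t → ∀ i, 0 ≤ z t i) ∧
  (∀ i, LocallyIntegrableOn (fun t => z t i) (Set.Ici (-(dbar R δ)))) ∧
  (∀ t, 0 ≤ t → FeasibleAt R δ lam c x z t (fun i => z t i)) ∧
  (∀ t, 0 ≤ t → ∀ w : E → ℝ, FeasibleAt R δ lam c x z t w → ∑ i, w i ≤ ∑ i, z t i) ∧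
  (∀ t, 0 ≤ t → ∀ i,
    x t i = x 0 i + ∫ s in (0:ℝ)..t, (lam s i + ∑ j, R j i * z (s - δ j i) j - z s i))

/-- Reachability in the directed graph on links with an edge from `j` to `i`
whenever `R j i > 0`. -/
def Reach (R : E → E → ℝ) : E → E → Prop :=
  Relation.TransGen fun a b => 0 < R a b

/-- Connectivity assumption: the graph is weakly connected, all row sums of `R` are at
most one, and from every link either its own row sum is less than one or a link with
row sum less than one is reachable. -/
def ConnAssumption [Fintype E] (R : E → E → ℝ) : Prop :=
  (∀ i j : E, i ≠ j → Reach R i j ∨ Reach R j i) ∧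
  (∀ i : E, ∑ l, R i l ≤ 1) ∧
  (∀ i : E, (∑ l, R i l < 1) ∨ ∃ j, Reach R i j ∧ ∑ l, R j l < 1)

/-- Stability condition: `c̄_i − Σ_j R j i * c̄_j > λ̄_i` for every link `i`, where bars
denote averages over one period `[0, T]`. -/
def Stability [Fintype E] (T : ℝ) (R : E → E → ℝ) (lam c : ℝ → E → ℝ) : Prop :=
  ∀ i : E, (1 / T) * ∫ s in (0:ℝ)..T, lam s i <
    (1 / T) * (∫ s in (0:ℝ)..T, c s i) -
      ∑ j, R j i * ((1 / T) * ∫ s in (0:ℝ)..T, c s j)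

theorem AbsolutelyContinuousOnInterval.abs {f : ℝ → ℝ} {a b : ℝ}
    (hf : AbsolutelyContinuousOnInterval f a b) :
    AbsolutelyContinuousOnInterval (fun t => |f t|) a b := by
  rw [absolutelyContinuousOnInterval_iff] at hf ⊢
  intro ε hε
  obtain ⟨δ, hδ, h⟩ := hf ε hε
  refine ⟨δ, hδ, fun I hI hI' => lt_of_le_of_lt (Finset.sum_le_sum fun i _ => ?_) (h I hI hI')⟩
  exact abs_abs_sub_abs_le _ _

/-- A primitive whose density `g` satisfies `sign y * g ≤ h` off the zeros of `y`, and `0 ≤ h` at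
them, has absolute value at most the integral of `h`. -/
theorem abs_le_integral_of_sign_mul_le {g h y : ℝ → ℝ} {T : ℝ} (hT : 0 ≤ T)
    (hg : IntervalIntegrable g volume 0 T) (hh : IntervalIntegrable h volume 0 T)
    (hy : ∀ t ∈ Set.Icc 0 T, y t = ∫ s in (0:ℝ)..t, g s)
    (hpos : ∀ t ∈ Set.Icc 0 T, 0 < y t → g t ≤ h t)
    (hneg : ∀ t ∈ Set.Icc 0 T, y t < 0 → -g t ≤ h t)
    (hzero : ∀ t ∈ Set.Icc 0 T, y t = 0 → 0 ≤ h t) :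
    |y T| ≤ ∫ s in (0:ℝ)..T, h s := by
  set Y : ℝ → ℝ := fun t => ∫ s in (0:ℝ)..t, g s with hY
  have hac := (hg.absolutelyContinuousOnInterval_intervalIntegral Set.left_mem_uIcc).abs
  have hftc := hac.integral_deriv_eq_sub
  have hY0 : Y 0 = 0 := by simp [hY]
  have hyT : y T = Y T := hy T ⟨hT, le_rfl⟩
  change _ = |Y T| - |Y 0| at hftc
  rw [hyT, show |Y T| = ∫ t in (0:ℝ)..T, deriv (fun t => |Y t|) t by rw [hftc, hY0]; simp]
  refine intervalIntegral.integral_mono_ae_restrict hT hac.intervalIntegrable_deriv hh ?_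
  rw [Filter.EventuallyLE, ae_restrict_iff' measurableSet_Icc]
  filter_upwards [hg.ae_hasDerivAt_integral] with t ht htT
  have hd : HasDerivAt Y (g t) t := ht (by rwa [Set.uIcc_of_le hT]) 0 Set.left_mem_uIcc
  have hyt := hy t htT
  rcases lt_trichotomy (Y t) 0 with hlt | heq | hgt
  · have hd' : HasDerivAt (fun t => |Y t|) (-1 * g t) t := (hasDerivAt_abs_neg hlt).comp t hd
    rw [hd'.deriv]
    linarith [hneg t htT (hyt.trans_lt hlt)]
  · rw [IsLocalMin.deriv_eq_zero]
    · exact hzero t htT (hyt.trans heq)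
    · exact Filter.Eventually.of_forall fun s => by simp [heq]
  · have hd' : HasDerivAt (fun t => |Y t|) (1 * g t) t := (hasDerivAt_abs_pos hgt).comp t hd
    rw [hd'.deriv]
    linarith [hpos t htT (hgt.trans_eq hyt.symm)]

/-- Comparison principle: if `y i` is a primitive of `∑ j, A j i * d j - d i`, where `A` is
row-substochastic, `d i` has the sign of `y i` off its zeros and is dominated by the inflow
at its zeros, then `y = 0`. -/
theorem eq_zero_of_substochastic_flow [Fintype E] {A : E → E → ℝ} (hA : ∀ j i, 0 ≤ A j i)
    (hrow : ∀ j, ∑ i, A j i ≤ 1) {y d : ℝ → E → ℝ} {T : ℝ} (hT : 0 ≤ T)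
    (hd : ∀ i, IntervalIntegrable (fun t => d t i) volume 0 T)
    (hy : ∀ t ∈ Set.Icc 0 T, ∀ i, y t i = ∫ s in (0:ℝ)..t, (∑ j, A j i * d s j - d s i))
    (hpos : ∀ t ∈ Set.Icc 0 T, ∀ i, 0 < y t i → 0 ≤ d t i)
    (hneg : ∀ t ∈ Set.Icc 0 T, ∀ i, y t i < 0 → d t i ≤ 0)
    (hzero : ∀ t ∈ Set.Icc 0 T, ∀ i, y t i = 0 → |d t i| ≤ ∑ j, A j i * |d t j|) (i : E) :
    y T i = 0 := by
  have habs : ∀ i, IntervalIntegrable (fun t => |d t i|) volume 0 T := fun i => (hd i).abs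
  have hh : ∀ i, IntervalIntegrable (fun t => ∑ j, A j i * |d t j| - |d t i|) volume 0 T := by
    intro i
    refine IntervalIntegrable.sub ?_ (habs i)
    have := IntervalIntegrable.sum (μ := volume) (a := 0) (b := T) Finset.univ
      (f := fun j t => A j i * |d t j|) fun j _ => (habs j).const_mul _
    simpa only [Finset.sum_fn] using this
  have hg : ∀ i, IntervalIntegrable (fun t => ∑ j, A j i * d t j - d t i) volume 0 T := by
    intro i
    refine IntervalIntegrable.sub ?_ (hd i)
    have := IntervalIntegrable.sum (μ := volume) (a := 0) (b := T) Finset.univ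
      (f := fun j t => A j i * d t j) fun j _ => (hd j).const_mul _
    simpa only [Finset.sum_fn] using this
  have hsum : ∀ t i, |∑ j, A j i * d t j| ≤ ∑ j, A j i * |d t j| := fun t i =>
    (Finset.abs_sum_le_sum_abs _ _).trans_eq
      (Finset.sum_congr rfl fun j _ => by rw [abs_mul, abs_of_nonneg (hA j i)])
  have hle : ∀ i, |y T i| ≤ ∫ s in (0:ℝ)..T, (∑ j, A j i * |d s j| - |d s i|) := by
    intro i
    refine abs_le_integral_of_sign_mul_le (g := fun s => ∑ j, A j i * d s j - d s i)
      (y := fun t => y t i) hT (hg i) (hh i) (fun t ht => hy t ht i) ?_ ?_ ?_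
    · intro t ht h
      simp only [abs_of_nonneg (hpos t ht i h)]
      linarith [le_abs_self (∑ j, A j i * d t j), hsum t i]
    · intro t ht h
      simp only [abs_of_nonpos (hneg t ht i h)]
      linarith [neg_abs_le (∑ j, A j i * d t j), hsum t i]
    · intro t ht h
      linarith [hzero t ht i h]
  have htot : ∑ i, |y T i| ≤ 0 := by
    calc ∑ i, |y T i| ≤ ∑ i, ∫ s in (0:ℝ)..T, (∑ j, A j i * |d s j| - |d s i|) :=
          Finset.sum_le_sum fun i _ => hle i
      _ = ∫ s in (0:ℝ)..T, ∑ i, (∑ j, A j i * |d s j| - |d s i|) :=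
          (intervalIntegral.integral_finsetSum fun i _ => hh i).symm
      _ ≤ 0 := by
          rw [← neg_nonneg, ← intervalIntegral.integral_neg]
          refine intervalIntegral.integral_nonneg hT fun s _ => neg_nonneg.2 ?_
          rw [Finset.sum_sub_distrib, Finset.sum_comm, ← Finset.sum_sub_distrib]
          refine Finset.sum_nonpos fun j _ => ?_
          rw [← Finset.sum_mul]
          nlinarith [hrow j, abs_nonneg (d s j)]
  have := (Finset.sum_eq_zero_iff_of_nonneg fun i _ => abs_nonneg (y T i)).1
    (le_antisymm htot (Finset.sum_nonneg fun i _ => abs_nonneg _)) i (Finset.mem_univ i)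
  exact abs_eq_zero.1 this

/-- Outflow vectors bounded by the capacities `c` and, on the links `S` with empty queue, by
the inflow `ℓ i + ∑ j, A j i * w j`. -/
def feasibleOutflows [Fintype E] (A : E → E → ℝ) (S : Set E) (c ℓ : E → ℝ) : Set (E → ℝ) :=
  {w | (∀ i, w i ≤ c i) ∧ ∀ i ∈ S, w i ≤ ℓ i + ∑ j, A j i * w j}

section feasibleOutflows

variable [Fintype E] {A : E → E → ℝ} {S S' : Set E} {c ℓ G w : E → ℝ}

theorem exists_isGreatest_feasibleOutflows (hA : ∀ j i, 0 ≤ A j i)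
    (hne : (feasibleOutflows A S c ℓ).Nonempty) :
    ∃ G, IsGreatest (feasibleOutflows A S c ℓ) G := by
  have hbdd : ∀ i, BddAbove ((fun w : E → ℝ => w i) '' feasibleOutflows A S c ℓ) := fun i =>
    ⟨c i, by rintro _ ⟨w, hw, rfl⟩; exact hw.1 i⟩
  have hle : ∀ w ∈ feasibleOutflows A S c ℓ, ∀ i,
      w i ≤ sSup ((fun w : E → ℝ => w i) '' feasibleOutflows A S c ℓ) := fun w hw i =>
    le_csSup (hbdd i) ⟨w, hw, rfl⟩
  refine ⟨fun i => sSup ((fun w : E → ℝ => w i) '' feasibleOutflows A S c ℓ), ⟨?_, ?_⟩, hle⟩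
  · intro i
    exact csSup_le (hne.image _) (by rintro _ ⟨w, hw, rfl⟩; exact hw.1 i)
  · intro i hi
    refine csSup_le (hne.image _) ?_
    rintro _ ⟨w, hw, rfl⟩
    refine (hw.2 i hi).trans ?_
    gcongr with j
    · exact hA j i
    · exact hle w hw j

theorem zero_mem_feasibleOutflows (hc : ∀ i, 0 ≤ c i) (hℓ : ∀ i, 0 ≤ ℓ i) :
    (fun _ => 0) ∈ feasibleOutflows A S c ℓ :=
  ⟨hc, fun i _ => by simpa using hℓ i⟩

theorem le_of_isGreatest_feasibleOutflows (hA : ∀ j i, 0 ≤ A j i)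
    (hG : IsGreatest (feasibleOutflows A S c ℓ) G) {i : E} {r : ℝ} (hrc : r ≤ c i)
    (hr : i ∈ S → r ≤ ℓ i + ∑ j, A j i * G j) : r ≤ G i := by
  classical
  by_contra! hlt
  have hle : G ≤ Function.update G i r := by
    intro j
    by_cases h : j = i
    · subst h; simpa using hlt.le
    · simp [h]
  have hmono : ∀ k, ℓ k + ∑ j, A j k * G j ≤ ℓ k + ∑ j, A j k * Function.update G i r j := by
    intro k
    gcongr with j
    · exact hA j k
    · exact hle j
  have hmem : Function.update G i r ∈ feasibleOutflows A S c ℓ := by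
    refine ⟨fun k => ?_, fun k hk => ?_⟩
    · by_cases h : k = i
      · subst h; simpa using hrc
      · simpa [h] using hG.1.1 k
    · refine le_trans ?_ (hmono k)
      by_cases h : k = i
      · subst h; simpa using hr hk
      · simpa [h] using hG.1.2 k hk
  have := hG.2 hmem i
  simp only [Function.update_self] at this
  exact absurd this (not_le.2 hlt)

theorem eq_capacity_of_isGreatest_feasibleOutflows (hA : ∀ j i, 0 ≤ A j i)
    (hG : IsGreatest (feasibleOutflows A S c ℓ) G) {i : E} (hi : i ∉ S) : G i = c i :=
  le_antisymm (hG.1.1 i) (le_of_isGreatest_feasibleOutflows hA hG le_rfl fun h => absurd h hi)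

theorem eq_min_of_isGreatest_feasibleOutflows (hA : ∀ j i, 0 ≤ A j i)
    (hG : IsGreatest (feasibleOutflows A S c ℓ) G) {i : E} (hi : i ∈ S) :
    G i = min (c i) (ℓ i + ∑ j, A j i * G j) :=
  le_antisymm (le_min (hG.1.1 i) (hG.1.2 i hi))
    (le_of_isGreatest_feasibleOutflows hA hG (min_le_left _ _) fun _ => min_le_right _ _)

/-- Dropping inflow constraints that are slack at the greatest feasible outflow does not
change it. -/
theorem IsGreatest.feasibleOutflows_of_slack (hA : ∀ j i, 0 ≤ A j i)
    (hG : IsGreatest (feasibleOutflows A S c ℓ) G) (hS : S' ⊆ S)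
    (hslack : ∀ i ∈ S, i ∉ S' → G i < ℓ i + ∑ j, A j i * G j) :
    IsGreatest (feasibleOutflows A S' c ℓ) G := by
  have hGmem : G ∈ feasibleOutflows A S' c ℓ := ⟨hG.1.1, fun i hi => hG.1.2 i (hS hi)⟩
  obtain ⟨v, hv⟩ := exists_isGreatest_feasibleOutflows hA ⟨G, hGmem⟩
  have hGv : G ≤ v := hv.2 hGmem
  have hev : ∀ᶠ θ in nhdsWithin (0:ℝ) (Set.Ioi 0), ∀ i, i ∈ S → i ∉ S' →
      G i + θ * (v i - G i) < ℓ i + ∑ j, A j i * (G j + θ * (v j - G j)) := by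
    refine Filter.eventually_all.2 fun i => ?_
    by_cases hi : i ∈ S ∧ i ∉ S'
    · have hcont : ∀ᶠ θ in nhds (0:ℝ),
          G i + θ * (v i - G i) < ℓ i + ∑ j, A j i * (G j + θ * (v j - G j)) := by
        refine ContinuousAt.eventually_lt (by fun_prop) (by fun_prop) ?_
        simpa using hslack i hi.1 hi.2
      exact (hcont.filter_mono nhdsWithin_le_nhds).mono fun θ h _ _ => h
    · exact Filter.Eventually.of_forall fun θ h h' => absurd ⟨h, h'⟩ hi
  have hone : ∀ᶠ θ in nhdsWithin (0:ℝ) (Set.Ioi 0), θ ≤ 1 :=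
    (eventually_le_nhds zero_lt_one).filter_mono nhdsWithin_le_nhds
  obtain ⟨θ, hθ, hθ1, hθ0⟩ := (hev.and (hone.and self_mem_nhdsWithin)).exists
  replace hθ0 : 0 < θ := hθ0
  have hmem : (fun i => G i + θ * (v i - G i)) ∈ feasibleOutflows A S c ℓ := by
    refine ⟨fun i => ?_, fun i hi => ?_⟩
    · nlinarith [hG.1.1 i, hv.1.1 i]
    · by_cases hi' : i ∈ S'
      · have h1 := hG.1.2 i hi
        have h2 := hv.1.2 i hi'
        have h3 : ∑ j, A j i * (G j + θ * (v j - G j)) =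
            (1 - θ) * ∑ j, A j i * G j + θ * ∑ j, A j i * v j := by
          rw [Finset.mul_sum, Finset.mul_sum, ← Finset.sum_add_distrib]
          exact Finset.sum_congr rfl fun j _ => by ring
        rw [h3]
        nlinarith [mul_le_mul_of_nonneg_left h1 (sub_nonneg.2 hθ1),
          mul_le_mul_of_nonneg_left h2 hθ0.le]
      · exact (hθ i hi hi').le
  have hvG : v = G := by
    refine le_antisymm (fun i => ?_) hGv
    have : G i + θ * (v i - G i) ≤ G i := hG.2 hmem i
    nlinarith
  rwa [hvG] at hv

/-- A feasible outflow of maximal total is the greatest feasible outflow. -/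
theorem isGreatest_feasibleOutflows_of_sum_le (hA : ∀ j i, 0 ≤ A j i)
    (hw : w ∈ feasibleOutflows A S c ℓ)
    (hmax : ∀ v ∈ feasibleOutflows A S c ℓ, ∑ i, v i ≤ ∑ i, w i) :
    IsGreatest (feasibleOutflows A S c ℓ) w := by
  obtain ⟨G, hG⟩ := exists_isGreatest_feasibleOutflows hA ⟨w, hw⟩
  have hle : w ≤ G := hG.2 hw
  have hsum : ∑ i, w i = ∑ i, G i :=
    le_antisymm (Finset.sum_le_sum fun i _ => hle i) (hmax G hG.1)
  have heq : w = G := funext fun i =>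
    (Finset.sum_eq_sum_iff_of_le fun i _ => hle i).1 hsum i (Finset.mem_univ i)
  rwa [heq]

end feasibleOutflows

/-- A function that is integrable on `[0, t]` for every `t < T` and bounded on `[0, T)` is
integrable on `[0, T]`. -/
theorem intervalIntegrable_of_forall_lt {f : ℝ → ℝ} {M T : ℝ}
    (hf : ∀ t ∈ Set.Ico 0 T, IntervalIntegrable f volume 0 t)
    (hM : ∀ t ∈ Set.Ico 0 T, ‖f t‖ ≤ M) (hT : 0 ≤ T) : IntervalIntegrable f volume 0 T := by
  rw [intervalIntegrable_iff_integrableOn_Ioo_of_le hT]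
  refine IntegrableOn.of_bound (by simp) ?_ M ?_
  · obtain ⟨u, -, hu, hlim⟩ := exists_seq_strictMono_tendsto T
    have hcov : Set.Ioo 0 T ⊆ ⋃ n, Set.Ioc 0 (u n) := fun t ht => by
      obtain ⟨n, hn⟩ := (hlim.eventually (lt_mem_nhds ht.2)).exists
      exact Set.mem_iUnion.2 ⟨n, ht.1, hn.le⟩
    suffices hm : AEStronglyMeasurable f (volume.restrict (⋃ n, Set.Ioc 0 (u n))) from
      hm.mono_set hcov
    refine aestronglyMeasurable_iUnion_iff.2 fun n => ?_
    rcases lt_or_ge (u n) 0 with hneg | hnn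
    · simp [Set.Ioc_eq_empty (not_lt.2 hneg.le)]
    · exact (hf (u n) ⟨hnn, hu n⟩).1.aestronglyMeasurable
  · exact (ae_restrict_iff' measurableSet_Ioo).2
      (Filter.Eventually.of_forall fun t ht => hM t ⟨ht.1.le, ht.2⟩)

theorem intervalIntegrable_delayed_of_history {R δ : E → E → ℝ} {h z : ℝ → E → ℝ} {t : ℝ}
    (hh : ∀ i a b, IntervalIntegrable (fun s => h s i) volume a b) (ht : 0 ≤ t)
    (hist : ∀ s < 0, z s = h s) (hz : ∀ i, IntervalIntegrable (fun s => z s i) volume 0 t)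
    (hδ : ∀ j i, 0 ≤ δ j i) (j i : E) :
    IntervalIntegrable (fun s => R j i * z (s - δ j i) j) volume 0 t := by
  have hneg : IntervalIntegrable (fun s => z s j) volume (-δ j i) 0 := by
    refine (hh j (-δ j i) 0).congr_uIoo fun s hs => ?_
    rw [Set.uIoo_of_le (neg_nonpos.2 (hδ j i))] at hs
    exact congrFun (hist s hs.2).symm j
  have hall : IntervalIntegrable (fun s => z s j) volume (-δ j i) (t - δ j i) := by
    refine (hneg.trans (hz j)).mono_set ?_
    rw [Set.uIcc_of_le (by linarith), Set.uIcc_of_le (by linarith [hδ j i])]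
    exact Set.Icc_subset_Icc_right (sub_le_self _ (hδ j i))
  have := (hall.comp_sub_right (δ j i)).const_mul (R j i)
  simpa using this

theorem tendsto_sub_const_nhdsGE (t d : ℝ) :
    Filter.Tendsto (fun s => s - d) (nhdsWithin t (Set.Ici t))
      (nhdsWithin (t - d) (Set.Ici (t - d))) := by
  refine tendsto_nhdsWithin_iff.2 ⟨?_, ?_⟩
  · exact ((continuous_id.sub continuous_const).tendsto t).mono_left nhdsWithin_le_nhds
  · filter_upwards [self_mem_nhdsWithin] with s hs
    exact sub_le_sub_right hs d

/-- Routing matrix restricted to the pairs of links with zero travel time. -/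
noncomputable def promptRouting (R δ : E → E → ℝ) (j i : E) : ℝ :=
  if δ j i = 0 then R j i else 0

theorem promptRouting_nonneg {R δ : E → E → ℝ} (hR : ∀ j i, 0 ≤ R j i) (j i : E) :
    0 ≤ promptRouting R δ j i := by
  unfold promptRouting
  split_ifs
  · exact hR j i
  · exact le_rfl

/-- External inflow plus the inflow routed from links with nonzero travel time. -/
noncomputable def effectiveInflow [Fintype E] (R δ : E → E → ℝ) (lam z : ℝ → E → ℝ)
    (t : ℝ) (i : E) : ℝ :=
  lam t i + ∑ j, if δ j i = 0 then 0 else R j i * z (t - δ j i) j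

/-- Rate of change of the queue lengths. -/
def netFlow [Fintype E] (R δ : E → E → ℝ) (lam z : ℝ → E → ℝ) (t : ℝ) (i : E) : ℝ :=
  lam t i + ∑ j, R j i * z (t - δ j i) j - z t i

section flow

variable [Fintype E] {R δ : E → E → ℝ} {lam lam' c c' x x' z z' : ℝ → E → ℝ} {x0 : E → ℝ}
  {t T : ℝ}

theorem effectiveInflow_add_prompt (w : E → ℝ) (i : E) :
    effectiveInflow R δ lam z t i + ∑ j, promptRouting R δ j i * w j =
      lam t i + ∑ j, R j i * (if δ j i = 0 then w j else z (t - δ j i) j) := by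
  rw [effectiveInflow, add_assoc, ← Finset.sum_add_distrib]
  congr 1
  refine Finset.sum_congr rfl fun j _ => ?_
  by_cases h : δ j i = 0 <;> simp [promptRouting, h]

theorem netFlow_eq (i : E) :
    netFlow R δ lam z t i =
      effectiveInflow R δ lam z t i + ∑ j, promptRouting R δ j i * z t j - z t i := by
  rw [effectiveInflow_add_prompt, netFlow]
  congr 2
  refine Finset.sum_congr rfl fun j _ => ?_
  by_cases h : δ j i = 0 <;> simp [h]

theorem feasibleAt_iff {w : E → ℝ} :
    FeasibleAt R δ lam c x z t w ↔
      w ∈ feasibleOutflows (promptRouting R δ) {i | x t i = 0} (c t)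
        (effectiveInflow R δ lam z t) := by
  simp only [FeasibleAt, feasibleOutflows, effectiveInflow_add_prompt, Set.mem_ofPred_eq]

theorem sum_promptRouting_le_one (hR : ∀ j i, 0 ≤ R j i) (hrow : ∀ j, ∑ i, R j i ≤ 1) (j : E) :
    ∑ i, promptRouting R δ j i ≤ 1 := by
  refine (Finset.sum_le_sum fun i _ => ?_).trans (hrow j)
  unfold promptRouting
  split_ifs
  · exact le_rfl
  · exact hR j i

theorem effectiveInflow_congr (hlam : lam t = lam' t)
    (hz : ∀ j i, δ j i ≠ 0 → R j i * z (t - δ j i) j = R j i * z' (t - δ j i) j) :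
    effectiveInflow R δ lam z t = effectiveInflow R δ lam' z' t := by
  funext i
  rw [effectiveInflow, effectiveInflow, hlam]
  congr 1
  refine Finset.sum_congr rfl fun j _ => ?_
  split_ifs with h
  · rfl
  · exact hz j i h

/-- The requirements of the traffic flow model at time `t ≥ 0`, for initial queues `x0`. -/
structure IsFlowAt (R δ : E → E → ℝ) (lam c : ℝ → E → ℝ) (x0 : E → ℝ) (x z : ℝ → E → ℝ)
    (t : ℝ) : Prop where
  queue_nonneg : ∀ i, 0 ≤ x t i
  greatest : IsGreatest (feasibleOutflows (promptRouting R δ) {i | x t i = 0} (c t)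
    (effectiveInflow R δ lam z t)) (z t)
  intervalIntegrable : ∀ i, IntervalIntegrable (fun s => z s i) volume 0 t
  intervalIntegrable_netFlow :
    ∀ i, IntervalIntegrable (fun s => netFlow R δ lam z s i) volume 0 t
  balance : ∀ i, x t i = x0 i + ∫ s in (0:ℝ)..t, netFlow R δ lam z s i

theorem IsFlowAt.outflow_eq_capacity (hR : ∀ j i, 0 ≤ R j i) (h : IsFlowAt R δ lam c x0 x z t)
    {i : E} (hi : 0 < x t i) : z t i = c t i :=
  eq_capacity_of_isGreatest_feasibleOutflows (promptRouting_nonneg hR) h.greatest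
    (by simpa using hi.ne')

/-- Two flows with equal delayed inflows on `[0, T]` have equal queues at time `T`. -/
theorem queue_eq_of_effectiveInflow_eq (hR : ∀ j i, 0 ≤ R j i) (hrow : ∀ j, ∑ i, R j i ≤ 1)
    (hT : 0 ≤ T) (h : ∀ t ∈ Set.Icc 0 T, IsFlowAt R δ lam c x0 x z t)
    (h' : ∀ t ∈ Set.Icc 0 T, IsFlowAt R δ lam c x0 x' z' t)
    (heff : ∀ t ∈ Set.Icc 0 T, effectiveInflow R δ lam z t = effectiveInflow R δ lam z' t) :
    x T = x' T := by
  have hA := promptRouting_nonneg (δ := δ) hR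
  have hTT : T ∈ Set.Icc 0 T := ⟨hT, le_rfl⟩
  funext i
  refine sub_eq_zero.1 (eq_zero_of_substochastic_flow (y := fun t i => x t i - x' t i)
    (d := fun t i => z t i - z' t i) hA (sum_promptRouting_le_one (δ := δ) hR hrow) hT
    (fun i => ((h T hTT).intervalIntegrable i).sub ((h' T hTT).intervalIntegrable i))
    ?_ ?_ ?_ ?_ i)
  · intro t ht i
    rw [(h t ht).balance, (h' t ht).balance, add_sub_add_left_eq_sub,
      ← intervalIntegral.integral_sub ((h t ht).intervalIntegrable_netFlow i)
        ((h' t ht).intervalIntegrable_netFlow i)]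
    refine intervalIntegral.integral_congr fun s hs => ?_
    rw [Set.uIcc_of_le ht.1] at hs
    simp only [netFlow_eq, heff s ⟨hs.1, hs.2.trans ht.2⟩, mul_sub, Finset.sum_sub_distrib]
    ring
  · intro t ht i hlt
    have hlt' : x' t i < x t i := sub_pos.1 hlt
    have := (h t ht).outflow_eq_capacity hR (((h' t ht).queue_nonneg i).trans_lt hlt')
    simp only [this, sub_nonneg]
    exact (h' t ht).greatest.1.1 i
  · intro t ht i hlt
    have hlt' : x t i < x' t i := sub_neg.1 hlt
    have := (h' t ht).outflow_eq_capacity hR (((h t ht).queue_nonneg i).trans_lt hlt')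
    simp only [this, sub_nonpos]
    exact (h t ht).greatest.1.1 i
  · intro t ht i heq
    have heq' : x t i = x' t i := sub_eq_zero.1 heq
    rcases ((h t ht).queue_nonneg i).eq_or_lt' with h0 | hpos
    · have h1 := eq_min_of_isGreatest_feasibleOutflows hA (h t ht).greatest (i := i) h0
      have h2 := eq_min_of_isGreatest_feasibleOutflows hA (h' t ht).greatest (i := i)
        (heq'.symm.trans h0)
      rw [h1, h2, heff t ht]
      refine (abs_min_sub_min_le_max _ _ _ _).trans (max_le ?_ ?_)
      · rw [sub_self, abs_zero]
        exact Finset.sum_nonneg fun j _ => mul_nonneg (hA j i) (abs_nonneg _)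
      · rw [add_sub_add_left_eq_sub, ← Finset.sum_sub_distrib]
        refine (Finset.abs_sum_le_sum_abs _ _).trans_eq (Finset.sum_congr rfl fun j _ => ?_)
        rw [← mul_sub, abs_mul, abs_of_nonneg (hA j i)]
    · rw [(h t ht).outflow_eq_capacity hR hpos,
        (h' t ht).outflow_eq_capacity hR (heq' ▸ hpos), sub_self, abs_zero]
      exact Finset.sum_nonneg fun j _ => mul_nonneg (hA j i) (abs_nonneg _)

/-- Uniqueness of flows with equal histories. -/
theorem flow_unique (hR : ∀ j i, 0 ≤ R j i) (hrow : ∀ j, ∑ i, R j i ≤ 1) {Δ : ℝ} (hΔ : 0 < Δ)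
    (hδ : ∀ j i, δ j i ≠ 0 → Δ ≤ δ j i) (h : ∀ t ∈ Set.Ico 0 T, IsFlowAt R δ lam c x0 x z t)
    (h' : ∀ t ∈ Set.Ico 0 T, IsFlowAt R δ lam c x0 x' z' t)
    (hist : ∀ t j i, 0 ≤ t → t - δ j i < 0 →
      R j i * z (t - δ j i) j = R j i * z' (t - δ j i) j) :
    ∀ t ∈ Set.Ico 0 T, x t = x' t ∧ z t = z' t := by
  have key : ∀ k : ℕ, ∀ t ∈ Set.Ico 0 T, t < k * Δ → x t = x' t ∧ z t = z' t := by
    intro k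
    induction k with
    | zero =>
      intro t ht hk
      simp only [Nat.cast_zero, zero_mul] at hk
      exact absurd ht.1 (not_le.2 hk)
    | succ k ih =>
      intro t ht hk
      have heff : ∀ s ∈ Set.Icc 0 t,
          effectiveInflow R δ lam z s = effectiveInflow R δ lam z' s := by
        intro s hs
        refine effectiveInflow_congr rfl fun j i hji => ?_
        rcases lt_or_ge (s - δ j i) 0 with hneg | hnn
        · exact hist s j i hs.1 hneg
        · have hle := hδ j i hji
          push_cast at hk
          rw [(ih (s - δ j i) ⟨hnn, by linarith [hs.2, ht.2]⟩ (by linarith [hs.2])).2]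
      have hsub : ∀ s ∈ Set.Icc 0 t, s ∈ Set.Ico 0 T := fun s hs =>
        ⟨hs.1, hs.2.trans_lt ht.2⟩
      have hx := queue_eq_of_effectiveInflow_eq hR hrow ht.1 (fun s hs => h s (hsub s hs))
        (fun s hs => h' s (hsub s hs)) heff
      refine ⟨hx, (h t ht).greatest.unique ?_⟩
      rw [heff t ⟨ht.1, le_rfl⟩, hx]
      exact (h' t ht).greatest
  intro t ht
  obtain ⟨k, hk⟩ := exists_nat_gt (t / Δ)
  exact key k t ht ((div_lt_iff₀ hΔ).1 hk)

theorem netFlow_congr (hlam : lam t = lam' t) (hz : z t = z' t)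
    (hdel : ∀ j i, R j i * z (t - δ j i) j = R j i * z' (t - δ j i) j) :
    netFlow R δ lam z t = netFlow R δ lam' z' t := by
  funext i
  rw [netFlow, netFlow, hlam, hz]
  congr 2
  exact Finset.sum_congr rfl fun j _ => hdel j i

theorem intervalIntegrable_netFlow
    (hlam : ∀ i, IntervalIntegrable (fun s => lam s i) volume 0 t)
    (hz : ∀ i, IntervalIntegrable (fun s => z s i) volume 0 t)
    (hdel : ∀ j i, IntervalIntegrable (fun s => R j i * z (s - δ j i) j) volume 0 t) (i : E) :
    IntervalIntegrable (fun s => netFlow R δ lam z s i) volume 0 t := by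
  have := IntervalIntegrable.sum (μ := volume) (a := 0) (b := t) Finset.univ
    (f := fun j s => R j i * z (s - δ j i) j) fun j _ => hdel j i
  exact ((hlam i).add (by simpa only [Finset.sum_fn] using this)).sub (hz i)

/-- The requirements of the traffic flow model at time `t ∈ ℝ`, including nonnegativity and
right-constancy of the outflow and the prescribed history `h`. -/
structure IsFlowWithHistoryAt (R δ : E → E → ℝ) (lam c : ℝ → E → ℝ) (x0 : E → ℝ)
    (h x z : ℝ → E → ℝ) (t : ℝ) : Prop where
  history : t < 0 → z t = h t
  outflow_nonneg : ∀ i, 0 ≤ z t i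
  right_const : ∀ᶠ s in nhdsWithin t (Set.Ici t), z s = z t
  flow : 0 ≤ t → IsFlowAt R δ lam c x0 x z t

variable {h : ℝ → E → ℝ}

theorem IsFlowWithHistoryAt.congr (hδ : ∀ j i, 0 ≤ δ j i)
    (H : IsFlowWithHistoryAt R δ lam c x0 h x z t) (ht : t < T) (hz : ∀ s < T, z' s = z s)
    (hx : 0 ≤ t → x' t = x t) : IsFlowWithHistoryAt R δ lam c x0 h x' z' t := by
  have hev : ∀ᶠ s in nhdsWithin t (Set.Ici t), s < T :=
    (eventually_lt_nhds ht).filter_mono nhdsWithin_le_nhds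
  have hnet : ∀ i, Set.EqOn (fun s => netFlow R δ lam z s i)
      (fun s => netFlow R δ lam z' s i) (Set.Iic t) := fun i s hs =>
    congrFun (netFlow_congr rfl (hz s (hs.trans_lt ht)).symm fun j i => by
      rw [hz _ (lt_of_le_of_lt (sub_le_self _ (hδ j i)) (hs.trans_lt ht))]) i
  refine ⟨fun h0 => (hz t ht).trans (H.history h0), fun i => ?_, ?_, fun h0 => ?_⟩
  · rw [hz t ht]; exact H.outflow_nonneg i
  · filter_upwards [hev, H.right_const] with s hs hs'
    rw [hz s hs, hz t ht, hs']
  · have F := H.flow h0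
    have hsub : Set.uIcc 0 t ⊆ Set.Iic t := by
      rw [Set.uIcc_of_le h0]; exact Set.Icc_subset_Iic_self
    have hsub' : Set.uIoc 0 t ⊆ Set.Iic t := Set.uIoc_subset_uIcc.trans hsub
    refine ⟨fun i => ?_, ?_, fun i => ?_, fun i => ?_, fun i => ?_⟩
    · rw [hx h0]; exact F.queue_nonneg i
    · rw [hx h0, hz t ht, effectiveInflow_congr (lam' := lam) (z' := z) rfl fun j i _ => by
        rw [hz _ (lt_of_le_of_lt (sub_le_self _ (hδ j i)) ht)]]
      exact F.greatest
    · refine (intervalIntegrable_congr fun s hs => ?_).1 (F.intervalIntegrable i)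
      exact congrFun (hz s ((hsub' hs).trans_lt ht)).symm i
    · exact (intervalIntegrable_congr ((hnet i).mono hsub')).1 (F.intervalIntegrable_netFlow i)
    · rw [hx h0, F.balance, intervalIntegral.integral_congr ((hnet i).mono hsub)]

/-- A flow up to time `T` can be prolonged beyond `T`. -/
theorem exists_flow_extension (hR : ∀ j i, 0 ≤ R j i) (hδ : ∀ j i, 0 ≤ δ j i)
    (hlam_nn : ∀ t i, 0 ≤ lam t i) (hc_nn : ∀ t i, 0 ≤ c t i) (hx0 : ∀ i, 0 ≤ x0 i)
    (hlam_rc : ∀ t, ∀ᶠ s in nhdsWithin t (Set.Ici t), lam s = lam t)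
    (hc_rc : ∀ t, ∀ᶠ s in nhdsWithin t (Set.Ici t), c s = c t)
    (hlam_int : ∀ i a b, IntervalIntegrable (fun s => lam s i) volume a b)
    (hc_bdd : ∀ i T, ∃ M, ∀ t ∈ Set.Icc 0 T, c t i ≤ M)
    (hh_int : ∀ i a b, IntervalIntegrable (fun s => h s i) volume a b) (hT : 0 ≤ T)
    (H : ∀ t < T, IsFlowWithHistoryAt R δ lam c x0 h x z t) :
    ∃ x' z' : ℝ → E → ℝ, ∃ T' > T, ∀ t < T', IsFlowWithHistoryAt R δ lam c x0 h x' z' t := by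
  have hA := promptRouting_nonneg (δ := δ) hR
  -- the flow up to time `T`
  have hz_int : ∀ i, IntervalIntegrable (fun s => z s i) volume 0 T := by
    intro i
    obtain ⟨M, hM⟩ := hc_bdd i T
    refine intervalIntegrable_of_forall_lt
      (fun t ht => ((H t ht.2).flow ht.1).intervalIntegrable i) (M := M) (fun t ht => ?_) hT
    rw [Real.norm_of_nonneg ((H t ht.2).outflow_nonneg i)]
    exact (((H t ht.2).flow ht.1).greatest.1.1 i).trans (hM t ⟨ht.1, ht.2.le⟩)
  have hz_of_pos : 0 < T → ∀ s < 0, z s = h s := fun hpos s hs =>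
    (H s (hs.trans hpos)).history hs
  have hnet_int : ∀ i, IntervalIntegrable (fun s => netFlow R δ lam z s i) volume 0 T := by
    rcases hT.eq_or_lt with rfl | hpos
    · simp
    · exact intervalIntegrable_netFlow (fun i => hlam_int i 0 T) hz_int
        (intervalIntegrable_delayed_of_history hh_int hT (hz_of_pos hpos) hz_int hδ)
  set xT : E → ℝ := fun i => x0 i + ∫ s in (0:ℝ)..T, netFlow R δ lam z s i with hxT_def
  have hxT : ∀ i, 0 ≤ xT i := by
    intro i
    rcases hT.eq_or_lt with hT0 | hpos
    · simp [hxT_def, ← hT0, hx0 i]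
    · have hcont : ContinuousOn (fun t => x0 i + ∫ s in (0:ℝ)..t, netFlow R δ lam z s i)
          (Set.Icc 0 T) := by
        have := intervalIntegral.continuousOn_primitive_interval'
          (hnet_int i) (Set.left_mem_uIcc)
        rw [Set.uIcc_of_le hT] at this
        exact continuousOn_const.add this
      have hcl : T ∈ closure (Set.Ico 0 T) := by
        rw [closure_Ico hpos.ne]; exact ⟨hT, le_rfl⟩
      refine ContinuousWithinAt.closure_le hcl continuousWithinAt_const
        ((hcont T ⟨hT, le_rfl⟩).mono Set.Ico_subset_Icc_self) fun t ht => ?_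
      have F := (H t ht.2).flow ht.1
      rw [← F.balance]
      exact F.queue_nonneg i
  -- the constant outflow after time `T`
  set ℓ : E → ℝ := effectiveInflow R δ lam z T with hℓ_def
  have hℓ : ∀ i, 0 ≤ ℓ i := by
    intro i
    refine add_nonneg (hlam_nn T i) (Finset.sum_nonneg fun j _ => ?_)
    split_ifs with hji
    · exact le_rfl
    · have hlt : T - δ j i < T := sub_lt_self _ ((hδ j i).lt_of_ne' hji)
      exact mul_nonneg (hR j i) ((H _ hlt).outflow_nonneg j)
  have hzero := zero_mem_feasibleOutflows (A := promptRouting R δ) (S := {i | xT i = 0})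
    (hc_nn T) hℓ
  obtain ⟨G, hG⟩ := exists_isGreatest_feasibleOutflows hA ⟨_, hzero⟩
  have hG_nn : ∀ i, 0 ≤ G i := hG.2 hzero
  set v : E → ℝ := fun i => ℓ i + ∑ j, promptRouting R δ j i * G j - G i with hv_def
  have hv_nn : ∀ i, xT i = 0 → 0 ≤ v i := fun i hi => sub_nonneg.2 (hG.1.2 i hi)
  -- a right neighbourhood of `T` on which the data are constant
  have hev : ∀ᶠ s in nhdsWithin T (Set.Ici T), lam s = lam T ∧ c s = c T ∧
      (∀ i, 0 < xT i → 0 < xT i + (s - T) * v i) ∧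
      ∀ j i, δ j i ≠ 0 → s - δ j i < T ∧ z (s - δ j i) = z (T - δ j i) := by
    refine (hlam_rc T).and ((hc_rc T).and (.and ?_ ?_))
    · refine Filter.eventually_all.2 fun i => ?_
      by_cases hi : 0 < xT i
      · have hcont : ContinuousAt (fun s => xT i + (s - T) * v i) T := by fun_prop
        exact ((hcont.eventually_const_lt (by simpa using hi)).filter_mono
          nhdsWithin_le_nhds).mono fun s hs _ => hs
      · exact Filter.Eventually.of_forall fun s h => absurd h hi
    · refine Filter.eventually_all.2 fun j => Filter.eventually_all.2 fun i => ?_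
      by_cases hji : δ j i = 0
      · exact Filter.Eventually.of_forall fun s h => absurd hji h
      · have hlt : T - δ j i < T := sub_lt_self _ ((hδ j i).lt_of_ne' hji)
        have htend := tendsto_sub_const_nhdsGE T (δ j i)
        have h1 : ∀ᶠ s in nhdsWithin (T - δ j i) (Set.Ici (T - δ j i)), s < T :=
          (eventually_lt_nhds hlt).filter_mono nhdsWithin_le_nhds
        filter_upwards [htend.eventually h1, htend.eventually (H _ hlt).right_const]
          with s hs hs' _ using ⟨hs, hs'⟩
  obtain ⟨T', hTT', hsub⟩ := mem_nhdsGE_iff_exists_Ico_subset.1 hev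
  refine ⟨fun t => if t < T then x t else fun i => xT i + (t - T) * v i,
    fun t => if t < T then z t else G, T', hTT', fun t ht => ?_⟩
  set x1 : ℝ → E → ℝ := fun t => if t < T then x t else fun i => xT i + (t - T) * v i with hx1
  set z1 : ℝ → E → ℝ := fun t => if t < T then z t else G with hz1
  have hz1_lt : ∀ s < T, z1 s = z s := fun s hs => if_pos hs
  have hz1_ge : ∀ s, T ≤ s → z1 s = G := fun s hs => if_neg (not_lt.2 hs)
  rcases lt_or_ge t T with htT | hTt
  · exact (H t htT).congr hδ htT hz1_lt fun _ => if_pos htT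
  have ht0 : 0 ≤ t := hT.trans hTt
  have hx1_t : x1 t = fun i => xT i + (t - T) * v i := if_neg (not_lt.2 hTt)
  have heff : ∀ s ∈ Set.Icc T t, effectiveInflow R δ lam z1 s = ℓ := by
    intro s hs
    obtain ⟨hl, -, -, hd⟩ := hsub ⟨hs.1, hs.2.trans_lt ht⟩
    rw [hℓ_def]
    funext i
    simp only [effectiveInflow, hl]
    congr 1
    refine Finset.sum_congr rfl fun j _ => ?_
    split_ifs with hji
    · rfl
    · rw [hz1_lt _ (hd j i hji).1, (hd j i hji).2]
  have hnet_ge : ∀ i, ∀ s ∈ Set.Icc T t, netFlow R δ lam z1 s i = v i := fun i s hs => by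
    rw [netFlow_eq, heff s hs, hz1_ge s hs.1]
  have hnet_lt : ∀ i, Set.EqOn (fun s => netFlow R δ lam z1 s i)
      (fun s => netFlow R δ lam z s i) (Set.Ioo 0 T) := fun i s hs =>
    congrFun (netFlow_congr rfl (hz1_lt s hs.2) fun j i => by
      rw [hz1_lt _ (lt_of_le_of_lt (sub_le_self _ (hδ j i)) hs.2)]) i
  have hnet1_int : ∀ i, IntervalIntegrable (fun s => netFlow R δ lam z1 s i) volume 0 T :=
    fun i => (hnet_int i).congr_uIoo (by rw [Set.uIoo_of_le hT]; exact (hnet_lt i).symm)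
  have hnet1_int' : ∀ i, IntervalIntegrable (fun s => netFlow R δ lam z1 s i) volume T t :=
    fun i => (intervalIntegrable_const (c := v i)).congr_uIoo (by
      rw [Set.uIoo_of_le hTt]
      exact fun s hs => (hnet_ge i s ⟨hs.1.le, hs.2.le⟩).symm)
  have hbalance : ∀ i, x1 t i = x0 i + ∫ s in (0:ℝ)..t, netFlow R δ lam z1 s i := by
    intro i
    have hafter : ∫ s in T..t, netFlow R δ lam z1 s i = (t - T) * v i := by
      rw [intervalIntegral.integral_congr (g := fun _ => v i)
        (by rw [Set.uIcc_of_le hTt]; exact hnet_ge i), intervalIntegral.integral_const, smul_eq_mul]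
    rw [← intervalIntegral.integral_add_adjacent_intervals (hnet1_int i) (hnet1_int' i),
      intervalIntegral.integral_congr_Ioo_of_le hT (hnet_lt i), hafter, hx1_t,
      ← add_assoc]
  obtain ⟨-, hct, hpos, -⟩ := hsub ⟨hTt, ht⟩
  refine ⟨fun h0 => absurd h0 (not_lt.2 ht0), fun i => ?_, ?_, fun _ =>
    ⟨fun i => ?_, ?_, fun i => ?_, fun i => (hnet1_int i).trans (hnet1_int' i), hbalance⟩⟩
  · rw [hz1_ge t hTt]; exact hG_nn i
  · filter_upwards [self_mem_nhdsWithin] with s hs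
    rw [hz1_ge t hTt, hz1_ge s (hTt.trans hs)]
  · rw [hx1_t]
    rcases (hxT i).eq_or_lt' with h0 | hlt
    · exact add_nonneg h0.ge (mul_nonneg (sub_nonneg.2 hTt) (hv_nn i h0))
    · exact (hpos i hlt).le
  · rw [hct, heff t ⟨hTt, le_rfl⟩, hz1_ge t hTt, hx1_t]
    refine hG.feasibleOutflows_of_slack hA (fun i hi => ?_) fun i hi hi' => ?_
    · by_contra h0
      exact (hpos i ((hxT i).lt_of_ne' h0)).ne' hi
    · have h0 : xT i = 0 := hi
      have hne : v i ≠ 0 := fun hv0 => hi' (by simp [h0, hv0])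
      exact sub_pos.1 ((hv_nn i h0).lt_of_ne' hne)
  · refine ((hz_int i).congr_uIoo ?_).trans
      ((intervalIntegrable_const (c := G i)).congr_uIoo ?_ : IntervalIntegrable _ volume T t)
    · rw [Set.uIoo_of_le hT]
      exact fun s hs => congrFun (hz1_lt s hs.2).symm i
    · rw [Set.uIoo_of_le hTt]
      exact fun s hs => congrFun (hz1_ge s hs.1.le).symm i

/-- Existence of a flow on the whole time axis. -/
theorem exists_flow (hR : ∀ j i, 0 ≤ R j i) (hδ : ∀ j i, 0 ≤ δ j i)
    (hrow : ∀ j, ∑ i, R j i ≤ 1) {Δ : ℝ} (hΔ : 0 < Δ) (hδΔ : ∀ j i, δ j i ≠ 0 → Δ ≤ δ j i)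
    (hlam_nn : ∀ t i, 0 ≤ lam t i) (hc_nn : ∀ t i, 0 ≤ c t i) (hx0 : ∀ i, 0 ≤ x0 i)
    (hh_nn : ∀ t i, 0 ≤ h t i)
    (hlam_rc : ∀ t, ∀ᶠ s in nhdsWithin t (Set.Ici t), lam s = lam t)
    (hc_rc : ∀ t, ∀ᶠ s in nhdsWithin t (Set.Ici t), c s = c t)
    (hh_rc : ∀ t, ∀ᶠ s in nhdsWithin t (Set.Ici t), h s = h t)
    (hlam_int : ∀ i a b, IntervalIntegrable (fun s => lam s i) volume a b)
    (hc_bdd : ∀ i T, ∃ M, ∀ t ∈ Set.Icc 0 T, c t i ≤ M)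
    (hh_int : ∀ i a b, IntervalIntegrable (fun s => h s i) volume a b) :
    ∃ x z : ℝ → E → ℝ, ∀ t, IsFlowWithHistoryAt R δ lam c x0 h x z t := by
  have hchoice : ∀ t : ℝ, ∃ xv zv : E → ℝ,
      (∃ T x z, t < T ∧ ∀ s < T, IsFlowWithHistoryAt R δ lam c x0 h x z s) →
      ∃ T x z, t < T ∧ (∀ s < T, IsFlowWithHistoryAt R δ lam c x0 h x z s) ∧
        x t = xv ∧ z t = zv := by
    intro t
    by_cases ht : ∃ T x z, t < T ∧ ∀ s < T, IsFlowWithHistoryAt R δ lam c x0 h x z s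
    · obtain ⟨T, x, z, htT, H⟩ := ht
      exact ⟨x t, z t, fun _ => ⟨T, x, z, htT, H, rfl, rfl⟩⟩
    · exact ⟨0, 0, fun h => absurd h ht⟩
  choose X Z hXZ using hchoice
  have hagree : ∀ T x z, (∀ s < T, IsFlowWithHistoryAt R δ lam c x0 h x z s) →
      ∀ s < T, IsFlowWithHistoryAt R δ lam c x0 h X Z s := by
    intro T x z H
    have heq : ∀ t < T, Z t = z t ∧ (0 ≤ t → X t = x t) := by
      intro t ht
      obtain ⟨T1, x1, z1, ht1, H1, hX, hZ⟩ := hXZ t ⟨T, x, z, ht, H⟩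
      rw [← hX, ← hZ]
      rcases lt_or_ge t 0 with hneg | hnn
      · exact ⟨by rw [(H t ht).history hneg, (H1 t ht1).history hneg],
          fun h0 => absurd h0 (not_le.2 hneg)⟩
      · have := flow_unique (T := min T T1) hR hrow hΔ hδΔ
          (fun s hs => (H1 s (hs.2.trans_le (min_le_right _ _))).flow hs.1)
          (fun s hs => (H s (hs.2.trans_le (min_le_left _ _))).flow hs.1)
          (fun s j i _ hs => by
            rw [(H1 _ (hs.trans_le (hnn.trans ht1.le))).history hs,
              (H _ (hs.trans_le (hnn.trans ht.le))).history hs])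
          t ⟨hnn, lt_min ht ht1⟩
        exact ⟨this.2, fun _ => this.1⟩
    exact fun s hs => (H s hs).congr hδ hs (fun r hr => (heq r hr).1) (heq s hs).2
  refine ⟨X, Z, ?_⟩
  by_contra! hbad
  obtain ⟨b, hb⟩ := hbad
  set S : Set ℝ := {T | ∀ s < T, IsFlowWithHistoryAt R δ lam c x0 h X Z s}
  have hbdd : BddAbove S := ⟨b, fun T hT => not_lt.1 fun hlt => hb (hT b hlt)⟩
  have hS0 : (0:ℝ) ∈ S := hagree 0 h h fun s hs =>
    ⟨fun _ => rfl, hh_nn s, hh_rc s, fun h0 => absurd h0 (not_le.2 hs)⟩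
  have hsup : ∀ s < sSup S, IsFlowWithHistoryAt R δ lam c x0 h X Z s := by
    intro s hs
    obtain ⟨T, hTS, hsT⟩ := exists_lt_of_lt_csSup ⟨0, hS0⟩ hs
    exact hTS s hsT
  obtain ⟨x', z', T', hT', H'⟩ := exists_flow_extension hR hδ hlam_nn hc_nn hx0 hlam_rc hc_rc
    hlam_int hc_bdd hh_int (le_csSup hbdd hS0) hsup
  exact absurd (le_csSup hbdd (hagree T' x' z' H')) (not_le.2 hT')

theorem IsSolution.congr_data (hlam : ∀ t, 0 ≤ t → lam t = lam' t)
    (hc : ∀ t, 0 ≤ t → c t = c' t) (H : IsSolution R δ lam c x z) :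
    IsSolution R δ lam' c' x z := by
  have hfeas : ∀ t w, 0 ≤ t → (FeasibleAt R δ lam c x z t w ↔ FeasibleAt R δ lam' c' x z t w) :=
    fun t w ht => by simp only [FeasibleAt, hlam t ht, hc t ht]
  obtain ⟨h1, h2, h3, h4, h5, h6⟩ := H
  refine ⟨h1, h2, h3, fun t ht => (hfeas t _ ht).1 (h4 t ht),
    fun t ht w hw => h5 t ht w ((hfeas t w ht).2 hw), fun t ht i => (h6 t ht i).trans ?_⟩
  congr 1
  refine intervalIntegral.integral_congr fun s hs => ?_
  rw [Set.uIcc_of_le ht] at hs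
  simp only [hlam s hs.1]

theorem le_dbar {j i : E} (h : 0 < R j i) : δ j i ≤ dbar R δ := by
  refine le_csSup (((Set.finite_range fun p : E × E => δ p.1 p.2).subset ?_).insert 0).bddAbove
    (Set.mem_insert_of_mem _ ⟨j, i, h, rfl⟩)
  rintro _ ⟨j, i, -, rfl⟩
  exact ⟨(j, i), rfl⟩

theorem dbar_nonneg : 0 ≤ dbar R δ := by
  refine le_csSup (((Set.finite_range fun p : E × E => δ p.1 p.2).subset ?_).insert 0).bddAbove
    (Set.mem_insert _ _)
  rintro _ ⟨j, i, -, rfl⟩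
  exact ⟨(j, i), rfl⟩

theorem dbar_eq_zero_or_exists : dbar R δ = 0 ∨ ∃ j i, δ j i = dbar R δ := by
  have hfin : (insert 0 {d : ℝ | ∃ j i, 0 < R j i ∧ δ j i = d}).Finite := by
    refine ((Set.finite_range fun p : E × E => δ p.1 p.2).subset ?_).insert 0
    rintro _ ⟨j, i, -, rfl⟩
    exact ⟨(j, i), rfl⟩
  rcases (Set.insert_nonempty _ _).csSup_mem hfin with h | ⟨j, i, -, h⟩
  · exact Or.inl h
  · exact Or.inr ⟨j, i, h⟩

theorem IsSolution.isFlowAt (hR : ∀ j i, 0 ≤ R j i)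
    (hlam_int : ∀ i a b, IntervalIntegrable (fun s => lam s i) volume a b)
    (hx0 : ∀ i, x 0 i = x0 i) (H : IsSolution R δ lam c x z) (ht : 0 ≤ t) :
    IsFlowAt R δ lam c x0 x z t := by
  obtain ⟨h1, h2, h3, h4, h5, h6⟩ := H
  have hint : ∀ i a b, -dbar R δ ≤ a → a ≤ b →
      IntervalIntegrable (fun s => z s i) volume a b := fun i a b ha hab =>
    (intervalIntegrable_iff_integrableOn_Icc_of_le hab).2 ((h3 i).integrableOn_compact_subset
      (fun s hs => ha.trans hs.1) isCompact_Icc)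
  have hz_int : ∀ i, IntervalIntegrable (fun s => z s i) volume 0 t := fun i =>
    hint i 0 t (neg_nonpos.2 dbar_nonneg) ht
  refine ⟨h1 t ht, ?_, hz_int, intervalIntegrable_netFlow (fun i => hlam_int i 0 t) hz_int ?_,
    fun i => by rw [h6 t ht i, hx0 i]; rfl⟩
  · exact isGreatest_feasibleOutflows_of_sum_le (promptRouting_nonneg hR)
      (feasibleAt_iff.1 (h4 t ht)) fun w hw => h5 t ht w (feasibleAt_iff.2 hw)
  · intro j i
    rcases (hR j i).eq_or_lt with h0 | hpos
    · simp [← h0]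
    · have := (hint j (-δ j i) (t - δ j i) (neg_le_neg (le_dbar hpos)) (by linarith)).comp_sub_right
        (δ j i)
      simpa using this.const_mul (R j i)

theorem isSolution_of_isFlowWithHistoryAt
    (hh_int : ∀ i a b, IntervalIntegrable (fun s => h s i) volume a b)
    (H : ∀ t, IsFlowWithHistoryAt R δ lam c x0 h x z t) :
    IsSolution R δ lam c x z ∧ ∀ i, x 0 i = x0 i := by
  have h0 : ∀ i, x 0 i = x0 i := fun i => by simp [((H 0).flow le_rfl).balance i]
  refine ⟨⟨fun t ht => ((H t).flow ht).queue_nonneg, fun t _ => (H t).outflow_nonneg,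
    fun i => ?_, fun t ht => feasibleAt_iff.2 ((H t).flow ht).greatest.1,
    fun t ht w hw => Finset.sum_le_sum fun i _ =>
      ((H t).flow ht).greatest.2 (feasibleAt_iff.1 hw) i,
    fun t ht i => by rw [((H t).flow ht).balance i, h0 i]; rfl⟩, h0⟩
  refine LocallyIntegrable.locallyIntegrableOn ?_ _
  intro t
  have hle : -(|t| + 1) ≤ 0 := by linarith [abs_nonneg t]
  have hge : 0 ≤ |t| + 1 := by linarith [abs_nonneg t]
  have hneg : IntervalIntegrable (fun s => z s i) volume (-(|t| + 1)) 0 := by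
    refine (hh_int i (-(|t| + 1)) 0).congr_uIoo fun s hs => ?_
    rw [Set.uIoo_of_le hle] at hs
    exact congrFun ((H s).history hs.2).symm i
  have hint := hneg.trans (((H _).flow hge).intervalIntegrable i)
  refine ⟨Set.Icc (-(|t| + 1)) (|t| + 1), Icc_mem_nhds ?_ ?_,
    (intervalIntegrable_iff_integrableOn_Icc_of_le (hle.trans hge)).1 hint⟩
  · linarith [neg_abs_le t]
  · linarith [le_abs_self t]

end flow

section floor

variable {Δ : ℝ}

theorem eventually_floor_div_eq (hΔ : 0 < Δ) (t : ℝ) :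
    ∀ᶠ s in nhdsWithin t (Set.Ici t), ⌊s / Δ⌋ = ⌊t / Δ⌋ := by
  have hlt : t < (⌊t / Δ⌋ + 1 : ℝ) * Δ := (div_lt_iff₀ hΔ).1 (Int.lt_floor_add_one _)
  filter_upwards [self_mem_nhdsWithin, (eventually_lt_nhds hlt).filter_mono nhdsWithin_le_nhds]
    with s hs hs'
  refine Int.floor_eq_iff.2 ⟨(Int.floor_le (t / Δ)).trans ?_, (div_lt_iff₀ hΔ).2 hs'⟩
  exact div_le_div_of_nonneg_right hs hΔ.le

theorem mem_Ico_floor_div (hΔ : 0 < Δ) (t : ℝ) :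
    t ∈ Set.Ico ((⌊t / Δ⌋ : ℝ) * Δ) ((⌊t / Δ⌋ + 1 : ℝ) * Δ) :=
  ⟨(le_div_iff₀ hΔ).1 (Int.floor_le _), (div_lt_iff₀ hΔ).1 (Int.lt_floor_add_one _)⟩

theorem exists_bound_comp_floor_div (hΔ : 0 < Δ) (g : ℤ → ℝ) (a b : ℝ) :
    ∃ M, ∀ t ∈ Set.Icc a b, ‖g ⌊t / Δ⌋‖ ≤ M := by
  obtain ⟨M, hM⟩ := ((Finset.Icc ⌊a / Δ⌋ ⌊b / Δ⌋).image fun k => ‖g k‖).bddAbove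
  refine ⟨M, fun t ht => hM ?_⟩
  refine Finset.mem_coe.2 (Finset.mem_image_of_mem _ (Finset.mem_Icc.2 ⟨?_, ?_⟩))
  · exact Int.floor_le_floor (div_le_div_of_nonneg_right ht.1 hΔ.le)
  · exact Int.floor_le_floor (div_le_div_of_nonneg_right ht.2 hΔ.le)

theorem intervalIntegrable_comp_floor_div (hΔ : 0 < Δ) (g : ℤ → ℝ) (a b : ℝ) :
    IntervalIntegrable (fun t => g ⌊t / Δ⌋) volume a b := by
  obtain ⟨M, hM⟩ := exists_bound_comp_floor_div hΔ g (min a b) (max a b)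
  have hmeas : Measurable fun t : ℝ => g ⌊t / Δ⌋ :=
    (measurable_of_countable g).comp (Int.measurable_floor.comp (measurable_id.div_const Δ))
  refine (intervalIntegrable_const (c := M)).mono_fun hmeas.aestronglyMeasurable ?_
  refine (ae_restrict_iff' measurableSet_uIoc).2 (Filter.Eventually.of_forall fun t ht => ?_)
  exact (hM t (Set.uIoc_subset_uIcc ht)).trans (Real.le_norm_self M)

end floor

/-- Existence and uniqueness of the solution of the traffic flow model under the
connectivity assumption, local piecewise constancy of `λ` and `c`, nonnegative initial
condition, piecewise constant nonnegative initial history, and commensurability. -/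
theorem traffic_flow_exists_unique [Fintype E] [Nonempty E]
    (R δ : E → E → ℝ) (lam c : ℝ → E → ℝ) (x0 : E → ℝ) (z0 : ℝ → E → ℝ)
    (hRnn : ∀ j i, 0 ≤ R j i) (hδnn : ∀ j i, 0 ≤ δ j i)
    (hconn : ConnAssumption R)
    (hlam_nn : ∀ t, 0 ≤ t → ∀ i, 0 ≤ lam t i)
    (hc_nn : ∀ t, 0 ≤ t → ∀ i, 0 ≤ c t i)
    (hlam_pwc : ∀ i, LocPwcOn (fun t => lam t i) (Set.Ici 0))
    (hc_pwc : ∀ i, LocPwcOn (fun t => c t i) (Set.Ici 0))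
    (hx0 : ∀ i, 0 ≤ x0 i)
    (hz0nn : ∀ s ∈ Set.Ico (-(dbar R δ)) 0, ∀ i, 0 ≤ z0 s i)
    (hz0pwc : ∀ i, PwcOn (fun t => z0 t i) (Set.Ico (-(dbar R δ)) 0))
    (hcomm : ∃ Δ : ℝ, 0 < Δ ∧ (∀ j i, ∃ m : ℕ, δ j i = m * Δ) ∧
      (∀ i, ∀ k : ℤ, ∀ u v : ℝ,
        u ∈ Set.Ico ((k : ℝ) * Δ) ((k + 1 : ℝ) * Δ) →
        v ∈ Set.Ico ((k : ℝ) * Δ) ((k + 1 : ℝ) * Δ) →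
        0 ≤ u → 0 ≤ v → lam u i = lam v i ∧ c u i = c v i) ∧
      (∀ i, ∀ k : ℤ, ∀ u v : ℝ,
        u ∈ Set.Ico ((k : ℝ) * Δ) ((k + 1 : ℝ) * Δ) →
        v ∈ Set.Ico ((k : ℝ) * Δ) ((k + 1 : ℝ) * Δ) →
        u ∈ Set.Ico (-(dbar R δ)) 0 → v ∈ Set.Ico (-(dbar R δ)) 0 →
        z0 u i = z0 v i)) :
    (∃ x z : ℝ → E → ℝ, IsSolution R δ lam c x z ∧ (∀ i, x 0 i = x0 i) ∧
      (∀ s ∈ Set.Ico (-(dbar R δ)) 0, ∀ i, z s i = z0 s i)) ∧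
    (∀ x z x' z' : ℝ → E → ℝ, IsSolution R δ lam c x z → IsSolution R δ lam c x' z' →
      (∀ i, x 0 i = x0 i) → (∀ i, x' 0 i = x0 i) →
      (∀ s ∈ Set.Ico (-(dbar R δ)) 0, ∀ i, z s i = z0 s i) →
      (∀ s ∈ Set.Ico (-(dbar R δ)) 0, ∀ i, z' s i = z0 s i) →
      ∀ t, 0 ≤ t → ∀ i, x t i = x' t i ∧ z t i = z' t i) := by
  obtain ⟨Δ, hΔ, hδm, hstep, hz0step⟩ := hcomm
  have hδΔ : ∀ j i, δ j i ≠ 0 → Δ ≤ δ j i := by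
    intro j i hne
    obtain ⟨m, hm⟩ := hδm j i
    have hm1 : (1 : ℝ) ≤ m := by
      rcases Nat.eq_zero_or_pos m with rfl | hpos
      · simp [hm] at hne
      · exact_mod_cast hpos
    rw [hm]
    exact le_mul_of_one_le_left hΔ.le hm1
  obtain ⟨m, hm⟩ : ∃ m : ℕ, dbar R δ = m * Δ := by
    rcases dbar_eq_zero_or_exists (R := R) (δ := δ) with h0 | ⟨j, i, h⟩
    · exact ⟨0, by simp [h0]⟩
    · exact h ▸ hδm j i
  set lam' : ℝ → E → ℝ := fun t => lam (max 0 (⌊t / Δ⌋ * Δ)) with hlam'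
  set c' : ℝ → E → ℝ := fun t => c (max 0 (⌊t / Δ⌋ * Δ)) with hc'
  set hist : ℝ → E → ℝ := fun t =>
    if -(m : ℤ) ≤ ⌊t / Δ⌋ ∧ ⌊t / Δ⌋ < 0 then z0 (⌊t / Δ⌋ * Δ) else 0 with hhist
  have hfloor_mem : ∀ t, (⌊t / Δ⌋ : ℝ) * Δ ∈
      Set.Ico ((⌊t / Δ⌋ : ℝ) * Δ) ((⌊t / Δ⌋ + 1 : ℝ) * Δ) := fun t =>
    ⟨le_rfl, by rw [add_mul, one_mul]; exact lt_add_of_pos_right _ hΔ⟩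
  have hdata : ∀ t, 0 ≤ t → ∀ i, lam t i = lam' t i ∧ c t i = c' t i := by
    intro t ht i
    have hk : 0 ≤ (⌊t / Δ⌋ : ℝ) * Δ :=
      mul_nonneg (by exact_mod_cast Int.floor_nonneg.2 (div_nonneg ht hΔ.le)) hΔ.le
    simp only [hlam', hc', max_eq_right hk]
    exact hstep i ⌊t / Δ⌋ t _ (mem_Ico_floor_div hΔ t) (hfloor_mem t) ht hk
  have hlam_eq : ∀ t, 0 ≤ t → lam t = lam' t := fun t ht => funext fun i => (hdata t ht i).1
  have hc_eq : ∀ t, 0 ≤ t → c t = c' t := fun t ht => funext fun i => (hdata t ht i).2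
  have hgrid_mem : ∀ k : ℤ, -(m : ℤ) ≤ k ∧ k < 0 → (k : ℝ) * Δ ∈ Set.Ico (-dbar R δ) 0 := by
    rintro k ⟨hk, hk0⟩
    have hk' : -(m : ℝ) ≤ k := by exact_mod_cast hk
    have hk0' : (k : ℝ) < 0 := by exact_mod_cast hk0
    refine ⟨?_, mul_neg_of_neg_of_pos hk0' hΔ⟩
    rw [hm, ← neg_mul]
    exact mul_le_mul_of_nonneg_right hk' hΔ.le
  have hhist_eq : ∀ s ∈ Set.Ico (-dbar R δ) 0, ∀ i, hist s i = z0 s i := by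
    intro s hs i
    have hk : -(m : ℤ) ≤ ⌊s / Δ⌋ ∧ ⌊s / Δ⌋ < 0 := by
      constructor
      · refine Int.le_floor.2 ((le_div_iff₀ hΔ).2 ?_)
        push_cast
        rw [neg_mul, ← hm]
        exact hs.1
      · exact Int.floor_lt.2 (by simpa using div_neg_of_neg_of_pos hs.2 hΔ)
    simp only [hhist, if_pos hk]
    exact hz0step i ⌊s / Δ⌋ _ s (hfloor_mem s) (mem_Ico_floor_div hΔ s) (hgrid_mem _ hk) hs
  have hhist_nn : ∀ t i, 0 ≤ hist t i := by
    intro t i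
    simp only [hhist]
    split_ifs with hk
    · exact hz0nn _ (hgrid_mem _ hk) i
    · exact le_rfl
  have hlam_int : ∀ i a b, IntervalIntegrable (fun s => lam' s i) volume a b := fun i =>
    intervalIntegrable_comp_floor_div hΔ fun k => lam (max 0 (k * Δ)) i
  have hhist_int : ∀ i a b, IntervalIntegrable (fun s => hist s i) volume a b := fun i =>
    intervalIntegrable_comp_floor_div hΔ fun k =>
      (if -(m : ℤ) ≤ k ∧ k < 0 then z0 (k * Δ) else 0) i
  have hc_bdd : ∀ i T, ∃ M, ∀ t ∈ Set.Icc 0 T, c' t i ≤ M := by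
    intro i T
    obtain ⟨M, hM⟩ := exists_bound_comp_floor_div hΔ (fun k => c (max 0 (k * Δ)) i) 0 T
    exact ⟨M, fun t ht => (Real.le_norm_self _).trans (hM t ht)⟩
  constructor
  · obtain ⟨x, z, H⟩ := exists_flow (lam := lam') (c := c') (x0 := x0) (h := hist) hRnn hδnn
      hconn.2.1 hΔ hδΔ (fun t => hlam_nn _ (le_max_left _ _)) (fun t => hc_nn _ (le_max_left _ _))
      hx0 hhist_nn
      (fun t => (eventually_floor_div_eq hΔ t).mono fun s hs => by simp only [hlam', hs])
      (fun t => (eventually_floor_div_eq hΔ t).mono fun s hs => by simp only [hc', hs])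
      (fun t => (eventually_floor_div_eq hΔ t).mono fun s hs => by simp only [hhist, hs])
      hlam_int hc_bdd hhist_int
    obtain ⟨hsol, hx⟩ := isSolution_of_isFlowWithHistoryAt hhist_int H
    refine ⟨x, z, hsol.congr_data (fun t ht => (hlam_eq t ht).symm)
      (fun t ht => (hc_eq t ht).symm), hx, fun s hs i => ?_⟩
    rw [(H s).history hs.2, hhist_eq s hs i]
  · intro x z x' z' H H' hx hx' hz hz' t ht i
    have key := flow_unique hRnn hconn.2.1 hΔ hδΔ (T := t + 1)
      (fun s hs => (H.congr_data hlam_eq hc_eq).isFlowAt hRnn hlam_int hx hs.1)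
      (fun s hs => (H'.congr_data hlam_eq hc_eq).isFlowAt hRnn hlam_int hx' hs.1)
      (fun s j i hs hneg => ?_) t ⟨ht, lt_add_one t⟩
    · exact ⟨congrFun key.1 i, congrFun key.2 i⟩
    · rcases (hRnn j i).eq_or_lt with h0 | hpos
      · simp [← h0]
      · have hmem : s - δ j i ∈ Set.Ico (-dbar R δ) 0 :=
          ⟨by linarith [le_dbar (δ := δ) hpos], hneg⟩
        rw [hz _ hmem j, hz' _ hmem j]
end

section
/- If λ̃ : [0,Δ) → [0,∞)^E is piecewise constant and componentwise non-increasing, and c : [0,Δ) → [0,∞)^E is constant, then for every initial condition x(0) ∈ [0,∞)^E there exists exactly one solution (x, z) of the zero-delay traffic model on [0,Δ); moreover, the outflow z is piecewise constant and componentwise non-increasing on [0,Δ). -/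
open MeasureTheory

variable {E : Type*}

/-- `w ∈ ℝ^E` is feasible at time `t` for the zero-delay traffic model with net inflow
`lt` (λ̃) and capacity `c`: `w i ≤ c t i` for every `i`, and
`w i ≤ λ̃_i(t) + Σ_{j ∈ E_i} R j i * w j` for every `i` with `x t i = 0`
(here `E_i = {j : R j i > 0}`, so the sum equals `Σ_j R j i * w j`). -/
def FeasibleAtZD [Fintype E] (R : E → E → ℝ) (lt c : ℝ → E → ℝ)
    (x : ℝ → E → ℝ) (t : ℝ) (w : E → ℝ) : Prop :=
  (∀ i, w i ≤ c t i) ∧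
  ∀ i, x t i = 0 → w i ≤ lt t i + ∑ j, R j i * w j

/-- `(x, z)` is a solution of the zero-delay traffic model on `[0, Δ)` with routing
matrix `R`, net inflow `lt` and capacity `c`: queue lengths and outflows are
nonnegative, `z` is locally integrable, at every `t ∈ [0, Δ)` the outflow `z t` is
feasible and maximizes `Σ_i w i` among feasible vectors, and the queue lengths satisfy
the integral mass-balance equation. -/
def IsSolutionZD [Fintype E] (R : E → E → ℝ) (lt c : ℝ → E → ℝ) (Δ : ℝ)
    (x z : ℝ → E → ℝ) : Prop :=
  (∀ t ∈ Set.Ico (0:ℝ) Δ, ∀ i, 0 ≤ x t i ∧ 0 ≤ z t i) ∧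
  (∀ i, LocallyIntegrableOn (fun t => z t i) (Set.Ico (0:ℝ) Δ)) ∧
  (∀ t ∈ Set.Ico (0:ℝ) Δ, FeasibleAtZD R lt c x t (fun i => z t i)) ∧
  (∀ t ∈ Set.Ico (0:ℝ) Δ, ∀ w : E → ℝ,
    FeasibleAtZD R lt c x t w → ∑ i, w i ≤ ∑ i, z t i) ∧
  (∀ t ∈ Set.Ico (0:ℝ) Δ, ∀ i,
    x t i = x 0 i + ∫ s in (0:ℝ)..t, (lt s i + ∑ j, R j i * z s j - z s i))


section StaticProblem

variable [Fintype E] {R : E → E → ℝ} {C l l' z : E → ℝ} {I J : Set E}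

/-- The outflows that respect the capacities `C` everywhere and the flow constraint with net
inflow `l` on the set `I` of links with empty queue. -/
def feasibleSet (R : E → E → ℝ) (C l : E → ℝ) (I : Set E) : Set (E → ℝ) :=
  {w | (∀ i, w i ≤ C i) ∧ ∀ i ∈ I, w i ≤ l i + ∑ j, R j i * w j}

/-- The componentwise supremum of the feasible outflows. -/
noncomputable def maxOutflow (R : E → E → ℝ) (C l : E → ℝ) (I : Set E) : E → ℝ :=
  fun i => sSup ((fun w : E → ℝ => w i) '' feasibleSet R C l I)

theorem sum_routing_mono (hR : ∀ j i, 0 ≤ R j i) {v w : E → ℝ} (h : v ≤ w) (i : E) :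
    ∑ j, R j i * v j ≤ ∑ j, R j i * w j :=
  Finset.sum_le_sum fun j _ => mul_le_mul_of_nonneg_left (h j) (hR j i)

theorem zero_mem_feasibleSet (hl : 0 ≤ l) (hC : 0 ≤ C) : (0 : E → ℝ) ∈ feasibleSet R C l I :=
  ⟨fun i => hC i, fun i _ => by simpa using hl i⟩

theorem isGreatest_maxOutflow (hR : ∀ j i, 0 ≤ R j i) (hl : 0 ≤ l) (hC : 0 ≤ C) :
    IsGreatest (feasibleSet R C l I) (maxOutflow R C l I) := by
  have hne : ∀ i, ((fun w : E → ℝ => w i) '' feasibleSet R C l I).Nonempty :=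
    fun i => ⟨_, Set.mem_image_of_mem _ (zero_mem_feasibleSet hl hC)⟩
  have hub : maxOutflow R C l I ∈ upperBounds (feasibleSet R C l I) := fun w hw i =>
    le_csSup ⟨C i, by rintro _ ⟨v, hv, rfl⟩; exact hv.1 i⟩ (Set.mem_image_of_mem _ hw)
  refine ⟨⟨fun i => csSup_le (hne i) ?_, fun i hi => csSup_le (hne i) ?_⟩, hub⟩
  · rintro _ ⟨v, hv, rfl⟩
    exact hv.1 i
  · rintro _ ⟨v, hv, rfl⟩
    have := sum_routing_mono hR (hub hv) i
    have := hv.2 i hi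
    dsimp only
    linarith

theorem feasibleSet_subset (hl : l ≤ l') (hI : J ⊆ I) :
    feasibleSet R C l I ⊆ feasibleSet R C l' J :=
  fun _ hw => ⟨hw.1, fun i hi => (hw.2 i (hI hi)).trans (by gcongr; exact hl i)⟩

/-- A greatest feasible outflow is below capacity only at links whose flow constraint is tight. -/
theorem tight_of_lt_capacity (hR : ∀ j i, 0 ≤ R j i) (hz : IsGreatest (feasibleSet R C l I) z)
    {i : E} (hi : z i < C i) : i ∈ I ∧ z i = l i + ∑ j, R j i * z j := by
  classical
  have raise : ∀ a, z i ≤ a → a ≤ C i → (i ∈ I → a ≤ l i + ∑ j, R j i * z j) → a ≤ z i := by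
    intro a hza haC haI
    have hle : z ≤ Function.update z i a := by
      intro k
      by_cases hk : k = i
      · subst hk; simpa using hza
      · simp [hk]
    have hmem : Function.update z i a ∈ feasibleSet R C l I := by
      refine ⟨fun k => ?_, fun k hk => ?_⟩
      · by_cases h : k = i
        · subst h; simpa using haC
        · simpa [h] using hz.1.1 k
      · have hs := sum_routing_mono hR hle k
        by_cases h : k = i
        · subst h
          rw [Function.update_self]
          linarith [haI hk]
        · rw [Function.update_of_ne h]
          linarith [hz.1.2 k hk]
    simpa using hz.2 hmem i
  have hiI : i ∈ I := by
    by_contra h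
    exact absurd (raise (C i) hi.le le_rfl fun h' => absurd h' h) (not_le.2 hi)
  refine ⟨hiI, le_antisymm (hz.1.2 i hiI) ?_⟩
  by_contra! hlt
  exact absurd (raise (min (C i) (l i + ∑ j, R j i * z j)) (le_min hi.le hlt.le) (min_le_left _ _)
    fun _ => min_le_right _ _) (not_le.2 (lt_min hi hlt))

/-- There is no room for a nonzero circulation among the links below capacity. -/
theorem eq_zero_of_le_routing (hR : ∀ j i, 0 ≤ R j i) (hz : IsGreatest (feasibleSet R C l I) z)
    {y : E → ℝ} (hy : 0 ≤ y) (hsupp : ∀ i, z i = C i → y i = 0)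
    (hle : ∀ i, z i < C i → y i ≤ ∑ j, R j i * y j) : y = 0 := by
  have hev : ∀ᶠ ε in nhdsWithin (0 : ℝ) (Set.Ioi 0), ∀ i, z i + ε * y i ≤ C i := by
    rw [Filter.eventually_all]
    intro i
    rcases (hz.1.1 i).eq_or_lt with h | h
    · simp [hsupp i h, h]
    · have ht : Filter.Tendsto (fun ε : ℝ => z i + ε * y i) (nhds 0) (nhds (z i + 0 * y i)) :=
        (by fun_prop : Continuous fun ε : ℝ => z i + ε * y i).tendsto 0
      rw [zero_mul, add_zero] at ht
      exact ((ht.eventually_lt_const h).filter_mono nhdsWithin_le_nhds).mono fun _ h => h.le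
  obtain ⟨ε, hε, hpos⟩ := (hev.and self_mem_nhdsWithin).exists
  have hpos : 0 < ε := hpos
  have hmem : (fun i => z i + ε * y i) ∈ feasibleSet R C l I := by
    refine ⟨hε, fun i hi => ?_⟩
    have hsum : ∑ j, R j i * (z j + ε * y j) = ∑ j, R j i * z j + ε * ∑ j, R j i * y j := by
      rw [Finset.mul_sum, ← Finset.sum_add_distrib]
      exact Finset.sum_congr rfl fun j _ => by ring
    rw [hsum]
    have h1 := hz.1.2 i hi
    have h2 : y i ≤ ∑ j, R j i * y j := by
      rcases (hz.1.1 i).eq_or_lt with h | h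
      · rw [hsupp i h]
        exact Finset.sum_nonneg fun j _ => mul_nonneg (hR j i) (hy j)
      · exact hle i h
    have h3 := mul_le_mul_of_nonneg_left h2 hpos.le
    linarith
  funext i
  have h := hz.2 hmem i
  have h0 : ε * y i ≤ 0 := by simpa using h
  exact le_antisymm (nonpos_of_mul_nonpos_right h0 hpos) (hy i)

/-- Flow constraints at links running at capacity can be dropped. -/
theorem isGreatest_feasibleSet_of_subset (hR : ∀ j i, 0 ≤ R j i)
    (hz : IsGreatest (feasibleSet R C l I) z) (hJI : J ⊆ I) (hJ : ∀ i, z i < C i → i ∈ J)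
    (hl : 0 ≤ l) (hC : 0 ≤ C) : IsGreatest (feasibleSet R C l J) z := by
  have hy := isGreatest_maxOutflow (I := J) hR hl hC
  have hzy : z ≤ maxOutflow R C l J := hy.2 (feasibleSet_subset le_rfl hJI hz.1)
  have hmem : maxOutflow R C l J ∈ feasibleSet R C l I := by
    refine ⟨hy.1.1, fun i hi => ?_⟩
    rcases (hz.1.1 i).eq_or_lt with h | h
    · have := sum_routing_mono hR hzy i
      have := hz.1.2 i hi
      have := hy.1.1 i
      linarith
    · exact hy.1.2 i (hJ i h)
  rwa [le_antisymm hzy (hz.2 hmem)]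

end StaticProblem

section Dynamics

variable [Fintype E] {R : E → E → ℝ} {lt c x z x' z' : ℝ → E → ℝ} {C x0 : E → ℝ} {Δ T t u : ℝ}

/-- The growth rate of the queue at link `i` under net inflow `l` and outflow `w`. -/
def netRate (R : E → E → ℝ) (l w : E → ℝ) (i : E) : ℝ :=
  l i + ∑ j, R j i * w j - w i

/-- The standing assumptions on the data of the model on `[0, Δ)`, with constant capacity `C`. -/
structure AdmissibleZD (R : E → E → ℝ) (lt c : ℝ → E → ℝ) (C : E → ℝ) (Δ : ℝ) : Prop where
  routing_nonneg : ∀ j i, 0 ≤ R j i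
  inflow_nonneg : ∀ t ∈ Set.Ico 0 Δ, 0 ≤ lt t
  inflow_antitone : ∀ i, AntitoneOn (fun t => lt t i) (Set.Ico 0 Δ)
  inflow_const_right : ∀ t ∈ Set.Ico 0 Δ, ∃ u > t, ∀ s ∈ Set.Ico t u, s < Δ → lt s = lt t
  capacity_eq : ∀ t ∈ Set.Ico 0 Δ, c t = C
  capacity_nonneg : 0 ≤ C

omit [Fintype E] in
theorem AdmissibleZD.mono (h : AdmissibleZD R lt c C Δ) (hT : T ≤ Δ) :
    AdmissibleZD R lt c C T where
  routing_nonneg := h.routing_nonneg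
  inflow_nonneg t ht := h.inflow_nonneg t (Set.Ico_subset_Ico_right hT ht)
  inflow_antitone i := (h.inflow_antitone i).mono (Set.Ico_subset_Ico_right hT)
  inflow_const_right t ht := by
    obtain ⟨u, hu, H⟩ := h.inflow_const_right t (Set.Ico_subset_Ico_right hT ht)
    exact ⟨u, hu, fun s hs hsT => H s hs (hsT.trans_le hT)⟩
  capacity_eq t ht := h.capacity_eq t (Set.Ico_subset_Ico_right hT ht)
  capacity_nonneg := h.capacity_nonneg

theorem IsSolutionZD.mono (h : IsSolutionZD R lt c Δ x z) (hT : T ≤ Δ) :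
    IsSolutionZD R lt c T x z := by
  have hsub : Set.Ico 0 T ⊆ Set.Ico 0 Δ := Set.Ico_subset_Ico_right hT
  obtain ⟨h1, h2, h3, h4, h5⟩ := h
  exact ⟨fun t ht => h1 t (hsub ht), fun i => (h2 i).mono_set hsub, fun t ht => h3 t (hsub ht),
    fun t ht => h4 t (hsub ht), fun t ht => h5 t (hsub ht)⟩

theorem AntitoneOn.integrableOn_Ico {f : ℝ → ℝ} (hf : AntitoneOn f (Set.Ico 0 T))
    (h0 : ∀ t ∈ Set.Ico 0 T, 0 ≤ f t) : IntegrableOn f (Set.Ico 0 T) := by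
  refine IntegrableOn.of_bound (by simp)
    (aemeasurable_restrict_of_antitoneOn measurableSet_Ico hf).aestronglyMeasurable (f 0) ?_
  refine (ae_restrict_iff' measurableSet_Ico).2 (Filter.Eventually.of_forall fun t ht => ?_)
  rw [Real.norm_of_nonneg (h0 t ht)]
  exact hf ⟨le_rfl, ht.1.trans_lt ht.2⟩ ht ht.1

omit [Fintype E] in
theorem AdmissibleZD.integrableOn_inflow (h : AdmissibleZD R lt c C Δ) (i : E) :
    IntegrableOn (fun t => lt t i) (Set.Ico 0 Δ) :=
  (h.inflow_antitone i).integrableOn_Ico fun t ht => h.inflow_nonneg t ht i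

theorem integrableOn_netRate {S : Set ℝ} (hlt : ∀ i, IntegrableOn (fun t => lt t i) S)
    (hz : ∀ i, IntegrableOn (fun t => z t i) S) (i : E) :
    IntegrableOn (fun t => netRate R (lt t) (z t) i) S := by
  unfold netRate
  exact ((hlt i).add (integrable_finsetSum _ fun j _ => (hz j).const_mul _)).sub (hz i)

theorem intervalIntegrable_of_integrableOn_Ico {f : ℝ → ℝ} (hf : IntegrableOn f (Set.Ico 0 T))
    (ht : 0 ≤ t) (htu : t ≤ u) (hu : u ≤ T) : IntervalIntegrable f volume t u :=
  (intervalIntegrable_iff_integrableOn_Ico_of_le htu).2 (hf.mono_set (Set.Ico_subset_Ico ht hu))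

/-- The outflow at each time is the greatest feasible one. -/
theorem IsSolutionZD.isGreatest (hs : IsSolutionZD R lt c Δ x z)
    (h : AdmissibleZD R lt c C Δ) (ht : t ∈ Set.Ico 0 Δ) :
    IsGreatest (feasibleSet R C (lt t) {i | x t i = 0}) (z t) := by
  have hg := isGreatest_maxOutflow (I := {i | x t i = 0}) h.routing_nonneg (h.inflow_nonneg t ht)
    h.capacity_nonneg
  have hc := h.capacity_eq t ht
  have hmem : z t ∈ feasibleSet R C (lt t) {i | x t i = 0} :=
    ⟨fun i => hc ▸ (hs.2.2.1 t ht).1 i, (hs.2.2.1 t ht).2⟩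
  have hle := hg.2 hmem
  have hsum := hs.2.2.2.1 t ht _ ⟨fun i => hc.symm ▸ hg.1.1 i, hg.1.2⟩
  have heq : z t = maxOutflow R C (lt t) {i | x t i = 0} := by
    funext i
    exact (Finset.sum_eq_sum_iff_of_le fun i _ => hle i).1
      (le_antisymm (Finset.sum_le_sum fun i _ => hle i) hsum) i (Finset.mem_univ i)
  rwa [heq]

theorem IsSolutionZD.integrableOn_outflow (hs : IsSolutionZD R lt c Δ x z)
    (h : AdmissibleZD R lt c C Δ) (i : E) : IntegrableOn (fun t => z t i) (Set.Ico 0 Δ) := by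
  refine IntegrableOn.of_bound (by simp) (hs.2.1 i).aestronglyMeasurable (C i) ?_
  refine (ae_restrict_iff' measurableSet_Ico).2 (Filter.Eventually.of_forall fun t ht => ?_)
  rw [Real.norm_of_nonneg (hs.1 t ht i).2]
  exact (hs.isGreatest h ht).1.1 i

theorem IsSolutionZD.queue_eq_add (hs : IsSolutionZD R lt c Δ x z)
    (h : AdmissibleZD R lt c C Δ) (ht : 0 ≤ t) (htu : t ≤ u) (hu : u < Δ) (i : E) :
    x u i = x t i + ∫ s in t..u, netRate R (lt s) (z s) i := by
  have hint := integrableOn_netRate (R := R) h.integrableOn_inflow (hs.integrableOn_outflow h) i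
  rw [hs.2.2.2.2 u ⟨ht.trans htu, hu⟩ i, hs.2.2.2.2 t ⟨ht, htu.trans_lt hu⟩ i, add_assoc]
  congr 1
  exact (intervalIntegral.integral_add_adjacent_intervals
    (intervalIntegrable_of_integrableOn_Ico hint le_rfl ht (htu.trans hu.le))
    (intervalIntegrable_of_integrableOn_Ico hint ht htu hu.le)).symm

theorem continuousOn_primitive_Icc {f : ℝ → ℝ} (hf : IntegrableOn f (Set.Ico 0 T)) (hT : 0 ≤ T) :
    ContinuousOn (fun t => ∫ s in (0 : ℝ)..t, f s) (Set.Icc 0 T) := by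
  have := intervalIntegral.continuousOn_primitive_interval (μ := volume) (f := f) (a := 0) (b := T)
    (by rwa [Set.uIcc_of_le hT, integrableOn_Icc_iff_integrableOn_Ico])
  rwa [Set.uIcc_of_le hT] at this

theorem IsSolutionZD.continuousOn_queue (hs : IsSolutionZD R lt c Δ x z)
    (h : AdmissibleZD R lt c C Δ) (i : E) : ContinuousOn (fun t => x t i) (Set.Ico 0 Δ) := by
  rcases le_or_gt 0 Δ with hΔ | hΔ
  · refine ContinuousOn.congr (f := fun t => x 0 i + ∫ s in (0 : ℝ)..t, netRate R (lt s) (z s) i)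
      ?_ fun t ht => hs.2.2.2.2 t ht i
    exact continuousOn_const.add ((continuousOn_primitive_Icc (integrableOn_netRate
      h.integrableOn_inflow (hs.integrableOn_outflow h) i) hΔ).mono Set.Ico_subset_Icc_self)
  · simp [Set.Ico_eq_empty hΔ.le.not_gt]

theorem IsSolutionZD.eventually_emptyQueues_subset (hs : IsSolutionZD R lt c Δ x z)
    (h : AdmissibleZD R lt c C Δ) (ht : t ∈ Set.Ico 0 Δ) :
    ∀ᶠ s in nhdsWithin t (Set.Ico 0 Δ), {i | x s i = 0} ⊆ {i | x t i = 0} := by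
  have : ∀ᶠ s in nhdsWithin t (Set.Ico 0 Δ), ∀ i, x s i = 0 → x t i = 0 := by
    rw [Filter.eventually_all]
    intro i
    by_cases hi : x t i = 0
    · simp [hi]
    · filter_upwards [(hs.continuousOn_queue h i t ht).eventually_ne hi] with s hs hs0
      exact absurd hs0 hs
  exact this

/-- Once the set of empty queues does not increase, the outflow does not change. -/
theorem IsSolutionZD.outflow_eq_of_subset (hs : IsSolutionZD R lt c Δ x z)
    (h : AdmissibleZD R lt c C Δ) (ht : 0 ≤ t) (htu : t ≤ u) (hu : u < Δ)
    (hlt : ∀ s ∈ Set.Icc t u, lt s = lt t)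
    (hsub : ∀ s ∈ Set.Icc t u, {i | x s i = 0} ⊆ {i | x t i = 0}) : z u = z t := by
  have hIco : ∀ s ∈ Set.Icc t u, s ∈ Set.Ico 0 Δ :=
    fun s hs => ⟨ht.trans hs.1, hs.2.trans_lt hu⟩
  have htI := hIco t ⟨le_rfl, htu⟩
  have huI := hIco u ⟨htu, le_rfl⟩
  have hR := h.routing_nonneg
  have hg := hs.isGreatest h htI
  have hge : ∀ s ∈ Set.Icc t u, z t ≤ z s := fun s hs' =>
    (hs.isGreatest h (hIco s hs')).2 (feasibleSet_subset (hlt s hs').ge (hsub s hs') hg.1)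
  have hzint : ∀ i, IntervalIntegrable (fun s => z s i - z t i) volume t u := fun i =>
    (intervalIntegrable_of_integrableOn_Ico (hs.integrableOn_outflow h i) ht htu hu.le).sub
      intervalIntegrable_const
  set y : E → ℝ := fun i => ∫ s in t..u, (z s i - z t i) with hy
  have hqueue : ∀ i, z t i < C i → x u i = ∑ j, R j i * y j - y i := by
    intro i hi
    obtain ⟨hi0, htight⟩ := tight_of_lt_capacity hR hg hi
    have hi0 : x t i = 0 := hi0
    rw [hs.queue_eq_add h ht htu hu i, hi0, zero_add]
    have hcongr : ∫ s in t..u, netRate R (lt s) (z s) i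
        = ∫ s in t..u, (∑ j, R j i * (z s j - z t j) - (z s i - z t i)) := by
      refine intervalIntegral.integral_congr fun s hs' => ?_
      rw [Set.uIcc_of_le htu] at hs'
      simp only [netRate, hlt s hs', mul_sub, Finset.sum_sub_distrib]
      linarith
    rw [hcongr, intervalIntegral.integral_sub _ (hzint i), intervalIntegral.integral_finsetSum]
    · simp [hy]
    · exact fun j _ => (hzint j).const_mul _
    · simpa only [Finset.sum_fn] using
        IntervalIntegrable.sum Finset.univ fun j _ => (hzint j).const_mul (R j i)
  have hy0 : y = 0 := by
    refine eq_zero_of_le_routing hR hg (fun i => ?_) (fun i hi => ?_) fun i hi => ?_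
    · exact intervalIntegral.integral_nonneg htu fun s hs' => sub_nonneg.2 (hge s hs' i)
    · have : ∫ s in t..u, (z s i - z t i) = ∫ s in t..u, (0 : ℝ) := by
        refine intervalIntegral.integral_congr fun s hs' => ?_
        rw [Set.uIcc_of_le htu] at hs'
        have h1 := (hs.isGreatest h (hIco s hs')).1.1 i
        have h2 := hge s hs' i
        linarith
      simp [hy, this]
    · have := hqueue i hi
      linarith [(hs.1 u huI i).1]
  have hg' : IsGreatest (feasibleSet R C (lt u) {i | x u i = 0}) (z t) := by
    rw [hlt u ⟨htu, le_rfl⟩]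
    refine isGreatest_feasibleSet_of_subset hR hg (hsub u ⟨htu, le_rfl⟩) (fun i hi => ?_)
      (h.inflow_nonneg t htI) h.capacity_nonneg
    simpa [hy0] using hqueue i hi
  exact (hs.isGreatest h huI).unique hg'

theorem IsSolutionZD.outflow_const_right (hs : IsSolutionZD R lt c Δ x z)
    (h : AdmissibleZD R lt c C Δ) (ht : t ∈ Set.Ico 0 Δ) :
    ∃ u > t, ∀ s ∈ Set.Ico t u, s < Δ → z s = z t := by
  obtain ⟨u₁, hu₁, H₁⟩ := h.inflow_const_right t ht
  have hev := hs.eventually_emptyQueues_subset h ht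
  rw [Filter.Eventually, Metric.mem_nhdsWithin_iff] at hev
  obtain ⟨ε, hε, H₂⟩ := hev
  refine ⟨min u₁ (t + ε), lt_min hu₁ (by linarith), fun s hst hsΔ => ?_⟩
  have hs₁ := hst.2.trans_le (min_le_left _ _)
  have hs₂ := hst.2.trans_le (min_le_right _ _)
  refine hs.outflow_eq_of_subset h ht.1 hst.1 hsΔ
    (fun r hr => H₁ r ⟨hr.1, hr.2.trans_lt hs₁⟩ (hr.2.trans_lt hsΔ)) fun r hr => H₂ ⟨?_, ?_⟩
  · rw [Metric.mem_ball, Real.dist_eq, abs_lt]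
    constructor <;> linarith [hr.1, hr.2]
  · exact ⟨ht.1.trans hr.1, hr.2.trans_lt hsΔ⟩

theorem IsSolutionZD.eventually_outflow_le (hs : IsSolutionZD R lt c Δ x z)
    (h : AdmissibleZD R lt c C Δ) (ht : t ∈ Set.Ico 0 Δ) :
    ∀ᶠ s in nhdsWithin t (Set.Ico 0 Δ), z t ≤ z s := by
  obtain ⟨u, hu, H⟩ := hs.outflow_const_right h ht
  filter_upwards [hs.eventually_emptyQueues_subset h ht, self_mem_nhdsWithin,
    mem_nhdsWithin_of_mem_nhds (Iio_mem_nhds hu)] with s hsub hsI hsu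
  rcases le_total s t with hst | hst
  · exact (hs.isGreatest h hsI).2 (feasibleSet_subset
      (fun i => h.inflow_antitone i hsI ht hst) hsub (hs.isGreatest h ht).1)
  · exact (H s ⟨hst, hsu⟩ hsI.2).ge

theorem IsSolutionZD.antitoneOn_outflow (hs : IsSolutionZD R lt c Δ x z)
    (h : AdmissibleZD R lt c C Δ) : AntitoneOn z (Set.Ico 0 Δ) := by
  intro a ha b hb hab
  have hsub : Set.Icc a b ⊆ Set.Ico 0 Δ :=
    fun s hs => ⟨ha.1.trans hs.1, hs.2.trans_lt hb.2⟩
  have key : Set.Icc a b ⊆ {s | z s ≤ z a} := by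
    refine IsClosed.Icc_subset_of_forall_exists_gt ?_ (le_refl (z a)) ?_
    · refine isClosed_of_closure_subset fun t ht => ?_
      have htI : t ∈ Set.Icc a b := isClosed_Icc.closure_subset_iff.2 Set.inter_subset_right ht
      rw [mem_closure_iff_frequently] at ht
      have hev := eventually_nhdsWithin_iff.1 (hs.eventually_outflow_le h (hsub htI))
      obtain ⟨s, hs1, hs2⟩ := (ht.and_eventually hev).exists
      exact ⟨(hs2 (hsub hs1.2)).trans hs1.1, htI⟩
    · rintro t ⟨hta, htI⟩ v hv
      obtain ⟨u, hu, H⟩ := hs.outflow_const_right h (hsub ⟨htI.1, htI.2.le⟩)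
      obtain ⟨s, hts, hsm⟩ := exists_between (lt_min hu (lt_min hv htI.2))
      simp only [lt_min_iff] at hsm
      exact ⟨s, (H s ⟨hts.le, hsm.1⟩ (hsm.2.2.trans hb.2)).le.trans hta, hts, hsm.2.1.le⟩
  exact key ⟨hab, le_rfl⟩

theorem IsSolutionZD.unique (hs : IsSolutionZD R lt c Δ x z) (hs' : IsSolutionZD R lt c Δ x' z')
    (h : AdmissibleZD R lt c C Δ) (h0 : x 0 = x' 0) (ht : t ∈ Set.Ico 0 Δ) :
    x t = x' t ∧ z t = z' t := by
  have hout : ∀ s ∈ Set.Ico 0 Δ, x s = x' s → z s = z' s := fun s hsI hx =>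
    (hs.isGreatest h hsI).unique (hx ▸ hs'.isGreatest h hsI)
  have hsub : Set.Icc 0 t ⊆ Set.Ico 0 Δ := fun s hs => ⟨hs.1, hs.2.trans_lt ht.2⟩
  have key : Set.Icc 0 t ⊆ {s | x s = x' s} := by
    refine IsClosed.Icc_subset_of_forall_exists_gt ?_ h0 ?_
    · have hcont : ContinuousOn (fun s => x s - x' s) (Set.Icc 0 t) := continuousOn_pi.2 fun i =>
        ((hs.continuousOn_queue h i).sub (hs'.continuousOn_queue h i)).mono hsub
      have := hcont.preimage_isClosed_of_isClosed isClosed_Icc (isClosed_singleton (x := 0))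
      convert this using 1
      ext s
      simp [sub_eq_zero, and_comm]
    · rintro r ⟨hr, hrI⟩ v hv
      have hrI' := hsub ⟨hrI.1, hrI.2.le⟩
      obtain ⟨u, hu, H⟩ := hs.outflow_const_right h hrI'
      obtain ⟨u', hu', H'⟩ := hs'.outflow_const_right h hrI'
      obtain ⟨s, hrs, hsm⟩ := exists_between (lt_min hu (lt_min hu' (lt_min hv hrI.2)))
      simp only [lt_min_iff] at hsm
      obtain ⟨hsu, hsu', hsv, hst⟩ := hsm
      have hsΔ := hst.trans ht.2
      refine ⟨s, ?_, hrs, hsv.le⟩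
      funext i
      rw [hs.queue_eq_add h hrI.1 hrs.le hsΔ, hs'.queue_eq_add h hrI.1 hrs.le hsΔ,
        congrFun (show x r = x' r from hr) i]
      congr 1
      refine intervalIntegral.integral_congr fun q hq => ?_
      rw [Set.uIcc_of_le hrs.le] at hq
      rw [H q ⟨hq.1, hq.2.trans_lt hsu⟩ (hq.2.trans_lt hsΔ),
        H' q ⟨hq.1, hq.2.trans_lt hsu'⟩ (hq.2.trans_lt hsΔ), hout r hrI' hr]
  have hx := key ⟨ht.1, le_rfl⟩
  exact ⟨hx, hout t ht hx⟩

end Dynamics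

section PiecewiseConstant

variable {f : ℝ → ℝ} {s : Set ℝ} {Δ t : ℝ}

theorem PwcOn.eventually_eq_right (hf : PwcOn f s) (ht : t ∈ s) :
    ∀ᶠ u in nhdsWithin t (Set.Ici t), u ∈ s → f u = f t := by
  obtain ⟨D, hD⟩ := hf
  have hev : ∀ᶠ u in nhdsWithin t (Set.Ici t), ∀ d ∈ D, d ∉ Set.Ioc t u := by
    rw [Filter.eventually_all_finset]
    intro d _
    rcases le_or_gt d t with h | h
    · exact Filter.Eventually.of_forall fun u hu => hu.1.not_ge h
    · filter_upwards [mem_nhdsWithin_of_mem_nhds (Iio_mem_nhds h)] with u hu hd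
      exact absurd hd.2 (not_le.2 hu)
  filter_upwards [hev, self_mem_nhdsWithin] with u hu htu hus
  exact (hD t ht u hus htu hu).symm

theorem PwcOn.finite_image (hf : PwcOn f s) : (f '' s).Finite := by
  obtain ⟨D, hD⟩ := hf
  have hle : ∀ u ∈ s, ∀ v ∈ s, u ≤ v → D.filter (· ≤ u) = D.filter (· ≤ v) → f u = f v := by
    intro u hu v hv huv heq
    refine hD u hu v hv huv fun d hd hduv => ?_
    have : d ∈ D.filter (· ≤ u) := heq ▸ Finset.mem_filter.2 ⟨hd, hduv.2⟩
    exact hduv.1.not_ge (Finset.mem_filter.1 this).2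
  refine Set.Finite.of_finite_image (f := fun a => (fun v => D.filter (· ≤ v)) '' (s ∩ f ⁻¹' {a}))
    (Set.Finite.subset (D.powerset.finite_toSet.powerset) ?_) ?_
  · rintro _ ⟨a, -, rfl⟩ _ ⟨v, -, rfl⟩
    exact Finset.mem_coe.2 (Finset.mem_powerset.2 (Finset.filter_subset _ D))
  · rintro _ ⟨u, hu, rfl⟩ _ ⟨v, hv, rfl⟩ heq
    obtain ⟨w, ⟨hw, hwv⟩, hwu⟩ := (Set.ext_iff.1 heq (D.filter (· ≤ u))).1 ⟨u, ⟨hu, rfl⟩, rfl⟩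
    have hwv : f w = f v := hwv
    rw [← hwv]
    rcases le_total u w with h | h
    · exact hle u hu w hw h hwu.symm
    · exact (hle w hw u hu h hwu).symm

theorem finite_image_of_pwcOn [Finite E] {g : ℝ → E → ℝ}
    (hg : ∀ i, PwcOn (fun t => g t i) s) : (g '' s).Finite := by
  refine (Set.Finite.pi fun i => (hg i).finite_image).subset ?_
  rintro _ ⟨t, ht, rfl⟩ i -
  exact ⟨t, ht, rfl⟩

theorem pwcOn_of_antitoneOn (hf : AntitoneOn f (Set.Ico 0 Δ)) (hfin : (f '' Set.Ico 0 Δ).Finite)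
    (hright : ∀ t ∈ Set.Ico 0 Δ, ∃ u > t, ∀ s ∈ Set.Ico t u, s < Δ → f s = f t) :
    PwcOn f (Set.Ico 0 Δ) := by
  classical
  refine ⟨hfin.toFinset.image fun a => sInf {s ∈ Set.Ico 0 Δ | f s ≤ a}, ?_⟩
  intro u hu v hv huv hD
  by_contra hne
  have hlt : f v < f u := lt_of_le_of_ne (hf hu hv huv) (Ne.symm hne)
  set A := {s ∈ Set.Ico 0 Δ | f s ≤ f v} with hA
  have hvA : v ∈ A := ⟨hv, le_rfl⟩
  obtain ⟨w, hw, H⟩ := hright u hu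
  have hlow : ∀ s ∈ A, min w v ≤ s := by
    rintro s ⟨hs, hsv⟩
    by_contra! h
    rcases le_total u s with hus | hus
    · exact absurd ((H s ⟨hus, h.trans_le (min_le_left _ _)⟩ hs.2).ge.trans hsv) (not_le.2 hlt)
    · exact absurd ((hf hs hu hus).trans hsv) (not_le.2 hlt)
  have huv' : u < v := lt_of_le_of_ne huv fun h => hne (h ▸ rfl)
  refine hD (sInf A) ?_ ⟨(lt_min hw huv').trans_le (le_csInf ⟨v, hvA⟩ hlow),
    csInf_le ⟨_, hlow⟩ hvA⟩
  exact Finset.mem_image.2 ⟨f v, by simpa using ⟨v, hv, rfl⟩, rfl⟩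

end PiecewiseConstant

section Existence

variable [Fintype E] {R : E → E → ℝ} {lt c x z z' : ℝ → E → ℝ} {C x0 : E → ℝ} {Δ T T' t : ℝ}

theorem IsSolutionZD.finite_image_outflow (hs : IsSolutionZD R lt c Δ x z)
    (h : AdmissibleZD R lt c C Δ) (hfin : (lt '' Set.Ico 0 Δ).Finite) (i : E) :
    ((fun t => z t i) '' Set.Ico 0 Δ).Finite := by
  refine ((hfin.prod (Set.finite_univ (α := Set E))).image
    fun p => maxOutflow R C p.1 p.2 i).subset ?_
  rintro _ ⟨t, ht, rfl⟩
  refine ⟨(lt t, {i | x t i = 0}), ⟨⟨t, ht, rfl⟩, Set.mem_univ _⟩, ?_⟩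
  exact congrFun ((isGreatest_maxOutflow h.routing_nonneg (h.inflow_nonneg t ht)
    h.capacity_nonneg).unique (hs.isGreatest h ht)) i

/-- The queue lengths that result from the initial condition `x0` under the outflow `z`. -/
noncomputable def queueOf (R : E → E → ℝ) (lt : ℝ → E → ℝ) (x0 : E → ℝ) (z : ℝ → E → ℝ) :
    ℝ → E → ℝ :=
  fun t i => x0 i + ∫ s in (0 : ℝ)..t, netRate R (lt s) (z s) i

theorem queueOf_congr (ht : 0 ≤ t) (hz : ∀ s ∈ Set.Ico 0 t, z s = z' s) :
    queueOf R lt x0 z t = queueOf R lt x0 z' t := by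
  funext i
  unfold queueOf
  congr 1
  refine intervalIntegral.integral_congr_Ioo_of_le ht fun s hs => ?_
  rw [hz s ⟨hs.1.le, hs.2⟩]

theorem isSolutionZD_queueOf (h : AdmissibleZD R lt c C T)
    (hint : ∀ i, IntegrableOn (fun t => z t i) (Set.Ico 0 T))
    (hq : ∀ t ∈ Set.Ico 0 T, 0 ≤ queueOf R lt x0 z t)
    (hg : ∀ t ∈ Set.Ico 0 T,
      IsGreatest (feasibleSet R C (lt t) {i | queueOf R lt x0 z t i = 0}) (z t)) :
    IsSolutionZD R lt c T (queueOf R lt x0 z) z := by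
  refine ⟨fun t ht i => ⟨hq t ht i, ?_⟩, fun i => (hint i).locallyIntegrableOn, fun t ht => ?_,
    fun t ht w hw => Finset.sum_le_sum fun i _ => (hg t ht).2 ?_ i, fun t ht i => ?_⟩
  · exact (hg t ht).2 (zero_mem_feasibleSet (h.inflow_nonneg t ht) h.capacity_nonneg) i
  · exact ⟨fun i => h.capacity_eq t ht ▸ (hg t ht).1.1 i, (hg t ht).1.2⟩
  · exact ⟨fun i => h.capacity_eq t ht ▸ hw.1 i, hw.2⟩
  · simp [queueOf, netRate]

/-- A solution on `[0, T)` can be continued past `T`. -/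
theorem IsSolutionZD.exists_extension (hs : IsSolutionZD R lt c T (queueOf R lt x0 z) z)
    (h : AdmissibleZD R lt c C Δ) (hx0 : ∀ i, 0 ≤ x0 i) (hT : 0 ≤ T) (hTΔ : T < Δ) :
    ∃ T' > T, T' ≤ Δ ∧ ∃ z', IsSolutionZD R lt c T' (queueOf R lt x0 z') z' := by
  have hTI : T ∈ Set.Ico 0 Δ := ⟨hT, hTΔ⟩
  have hR := h.routing_nonneg
  have hzint := hs.integrableOn_outflow (h.mono hTΔ.le)
  set q := queueOf R lt x0 z T with hq
  have hq0 : 0 ≤ q := by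
    intro i
    rcases hT.eq_or_lt with h0 | hpos
    · simpa [hq, ← h0, queueOf] using hx0 i
    · have hcont : ContinuousOn (fun t => queueOf R lt x0 z t i) (Set.Icc 0 T) :=
        continuousOn_const.add (continuousOn_primitive_Icc (integrableOn_netRate
          (h.mono hTΔ.le).integrableOn_inflow hzint i) hT)
      have hmem : T ∈ closure (Set.Ico 0 T) := by
        rw [closure_Ico hpos.ne]
        exact ⟨hT, le_rfl⟩
      exact ContinuousWithinAt.closure_le (f := fun _ => (0 : ℝ))
        (g := fun t => queueOf R lt x0 z t i) hmem continuousWithinAt_const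
        ((hcont T ⟨hT, le_rfl⟩).mono Set.Ico_subset_Icc_self) fun t ht => (hs.1 t ht i).1
  set w := maxOutflow R C (lt T) {i | q i = 0} with hw
  have hg : IsGreatest (feasibleSet R C (lt T) {i | q i = 0}) w :=
    isGreatest_maxOutflow hR (h.inflow_nonneg T hTI) h.capacity_nonneg
  set v := netRate R (lt T) w with hv
  have hpos : ∀ᶠ s in nhdsWithin T (Set.Ici T), ∀ i, q i ≠ 0 → 0 < q i + (s - T) * v i := by
    rw [Filter.eventually_all]
    intro i
    by_cases hi : q i = 0
    · simp [hi]
    · have ht : Filter.Tendsto (fun s => q i + (s - T) * v i) (nhds T)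
          (nhds (q i + (T - T) * v i)) :=
        (by fun_prop : Continuous fun s => q i + (s - T) * v i).tendsto T
      rw [sub_self, zero_mul, add_zero] at ht
      filter_upwards [nhdsWithin_le_nhds
        (ht.eventually_const_lt (lt_of_le_of_ne (hq0 i) (Ne.symm hi)))] with s hs _ using hs
  obtain ⟨u₁, hu₁, H₁⟩ := h.inflow_const_right T hTI
  obtain ⟨u₂, hu₂, H₂⟩ := mem_nhdsGE_iff_exists_Ico_subset.1 hpos
  set T' := min u₁ (min u₂ Δ) with hT'
  have hTT' : T < T' := lt_min hu₁ (lt_min hu₂ hTΔ)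
  have hT'Δ : T' ≤ Δ := (min_le_right _ _).trans (min_le_right _ _)
  have hlt : ∀ s ∈ Set.Ico T T', lt s = lt T := fun s hs =>
    H₁ s ⟨hs.1, hs.2.trans_le (min_le_left _ _)⟩ (hs.2.trans_le hT'Δ)
  set z' : ℝ → E → ℝ := fun s => if s < T then z s else w with hz'
  have hz'l : ∀ s, s < T → z' s = z s := fun s hs => if_pos hs
  have hz'r : ∀ s, T ≤ s → z' s = w := fun s hs => if_neg hs.not_gt
  have hint : ∀ i, IntegrableOn (fun t => z' t i) (Set.Ico 0 T') := by
    intro i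
    rw [← Set.Ico_union_Ico_eq_Ico hT hTT'.le]
    refine ((hzint i).congr_fun (fun s hs => ?_) measurableSet_Ico).union
      (IntegrableOn.congr_fun (f := fun _ => w i) (integrableOn_const (by simp))
        (fun s hs => ?_) measurableSet_Ico)
    · exact congrFun (hz'l s hs.2).symm i
    · exact congrFun (hz'r s hs.1).symm i
  have hql : ∀ s, 0 ≤ s → s ≤ T → queueOf R lt x0 z' s = queueOf R lt x0 z s :=
    fun s hs hsT => queueOf_congr hs fun r hr => hz'l r (hr.2.trans_le hsT)
  have hrate := integrableOn_netRate (R := R) (h.mono hT'Δ).integrableOn_inflow hint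
  have hqr : ∀ s ∈ Set.Ico T T', ∀ i, queueOf R lt x0 z' s i = q i + (s - T) * v i := by
    intro s hs i
    have hconst : ∫ r in T..s, netRate R (lt r) (z' r) i = ∫ _ in T..s, v i := by
      refine intervalIntegral.integral_congr fun r hr => ?_
      rw [Set.uIcc_of_le hs.1] at hr
      simp only [hz'r r hr.1, hlt r ⟨hr.1, hr.2.trans_lt hs.2⟩, hv]
    rw [hq, ← hql T hT le_rfl]
    unfold queueOf
    rw [← intervalIntegral.integral_add_adjacent_intervals
      (intervalIntegrable_of_integrableOn_Ico (hrate i) le_rfl hT hTT'.le)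
      (intervalIntegrable_of_integrableOn_Ico (hrate i) hT hs.1 hs.2.le), hconst]
    simp [add_assoc]
  have hpos' : ∀ s ∈ Set.Ico T T', ∀ i, q i ≠ 0 → 0 < q i + (s - T) * v i := fun s hs =>
    H₂ ⟨hs.1, hs.2.trans_le ((min_le_right _ _).trans (min_le_left _ _))⟩
  refine ⟨T', hTT', hT'Δ, z', isSolutionZD_queueOf (h.mono hT'Δ) hint (fun s hsI => ?_)
    fun s hsI => ?_⟩
  · rcases lt_or_ge s T with hsT | hsT
    · rw [hql s hsI.1 hsT.le]
      exact fun i => (hs.1 s ⟨hsI.1, hsT⟩ i).1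
    · intro i
      rw [hqr s ⟨hsT, hsI.2⟩]
      by_cases hi : q i = 0
      · have hvi : 0 ≤ v i := sub_nonneg.2 (hg.1.2 i hi)
        rw [hi, zero_add]
        exact mul_nonneg (sub_nonneg.2 hsT) hvi
      · exact (hpos' s ⟨hsT, hsI.2⟩ i hi).le
  · rcases lt_or_ge s T with hsT | hsT
    · rw [hql s hsI.1 hsT.le, hz'l s hsT]
      exact hs.isGreatest (h.mono hTΔ.le) ⟨hsI.1, hsT⟩
    · have hsI' : s ∈ Set.Ico T T' := ⟨hsT, hsI.2⟩
      rw [hz'r s hsT, hlt s hsI']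
      refine isGreatest_feasibleSet_of_subset hR hg (fun i hi => ?_) (fun i hi => ?_)
        (h.inflow_nonneg T hTI) h.capacity_nonneg
      · by_contra hqi
        have := hpos' s hsI' i hqi
        rw [← hqr s hsI' i] at this
        exact this.ne' hi
      · obtain ⟨hqi, htight⟩ := tight_of_lt_capacity hR hg hi
        have hvi : v i = 0 := sub_eq_zero.2 htight.symm
        have hqi : q i = 0 := hqi
        change queueOf R lt x0 z' s i = 0
        rw [hqr s hsI' i, hqi, hvi, mul_zero, add_zero]

theorem IsSolutionZD.outflow_eq_outflow (hs : IsSolutionZD R lt c T (queueOf R lt x0 z) z)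
    (hs' : IsSolutionZD R lt c T' (queueOf R lt x0 z') z') (h : AdmissibleZD R lt c C Δ)
    (hT : T ≤ Δ) (ht : 0 ≤ t) (htT : t < T) (htT' : t < T') : z t = z' t :=
  ((hs.mono (min_le_left T T')).unique (hs'.mono (min_le_right T T'))
    (h.mono ((min_le_left T T').trans hT)) (by funext i; simp [queueOf])
    ⟨ht, lt_min htT htT'⟩).2

/-- Solutions on the intervals `[0, T)`, `T < Δ`, combine to a solution on `[0, Δ)`. -/
theorem AdmissibleZD.exists_solution_of_forall_lt (h : AdmissibleZD R lt c C Δ)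
    (hex : ∀ t ∈ Set.Ico 0 Δ, ∃ T > t, T ≤ Δ ∧ ∃ z, IsSolutionZD R lt c T (queueOf R lt x0 z) z) :
    ∃ z, IsSolutionZD R lt c Δ (queueOf R lt x0 z) z := by
  choose! T hT hTΔ Z hZ using hex
  have hagree : ∀ t ∈ Set.Ico 0 Δ, ∀ s ∈ Set.Icc 0 t, Z s s = Z t s := by
    intro t ht s hst
    have hsI : s ∈ Set.Ico 0 Δ := ⟨hst.1, hst.2.trans_lt ht.2⟩
    exact (hZ s hsI).outflow_eq_outflow (hZ t ht) h (hTΔ s hsI) hst.1 (hT s hsI)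
      (hst.2.trans_lt (hT t ht))
  have hanti : AntitoneOn (fun t => Z t t) (Set.Ico 0 Δ) := by
    intro a ha b hb hab
    dsimp only
    rw [hagree b hb a ⟨ha.1, hab⟩]
    exact (hZ b hb).antitoneOn_outflow (h.mono (hTΔ b hb)) ⟨ha.1, hab.trans_lt (hT b hb)⟩
      ⟨hb.1, hT b hb⟩ hab
  have hqueue : ∀ t ∈ Set.Ico 0 Δ,
      queueOf R lt x0 (fun t => Z t t) t = queueOf R lt x0 (Z t) t := fun t ht =>
    queueOf_congr ht.1 fun s hs => hagree t ht s ⟨hs.1, hs.2.le⟩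
  refine ⟨fun t => Z t t, isSolutionZD_queueOf h (fun i => ?_) (fun t ht => ?_) fun t ht => ?_⟩
  · exact AntitoneOn.integrableOn_Ico (fun a ha b hb hab => hanti ha hb hab i)
      fun t ht => ((hZ t ht).1 t ⟨ht.1, hT t ht⟩ i).2
  · rw [hqueue t ht]
    exact fun i => ((hZ t ht).1 t ⟨ht.1, hT t ht⟩ i).1
  · rw [hqueue t ht]
    exact (hZ t ht).isGreatest (h.mono (hTΔ t ht)) ⟨ht.1, hT t ht⟩

theorem AdmissibleZD.exists_solution (h : AdmissibleZD R lt c C Δ) (hx0 : ∀ i, 0 ≤ x0 i)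
    (hΔ : 0 ≤ Δ) : ∃ z, IsSolutionZD R lt c Δ (queueOf R lt x0 z) z := by
  set S := {T | 0 ≤ T ∧ T ≤ Δ ∧ ∃ z, IsSolutionZD R lt c T (queueOf R lt x0 z) z} with hS
  have h0 : (0 : ℝ) ∈ S :=
    ⟨le_rfl, hΔ, 0, by simp [IsSolutionZD, LocallyIntegrableOn]⟩
  have hbdd : BddAbove S := ⟨Δ, fun T hT => hT.2.1⟩
  have hτ0 : 0 ≤ sSup S := le_csSup hbdd h0
  have hτΔ : sSup S ≤ Δ := csSup_le ⟨0, h0⟩ fun T hT => hT.2.1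
  obtain ⟨z, hz⟩ := (h.mono hτΔ).exists_solution_of_forall_lt (x0 := x0) fun t ht => by
    obtain ⟨T, hTS, htT⟩ := exists_lt_of_lt_csSup ⟨0, h0⟩ ht.2
    exact ⟨T, htT, le_csSup hbdd hTS, hTS.2.2⟩
  rcases hτΔ.eq_or_lt with heq | hlt
  · exact ⟨z, heq ▸ hz⟩
  · obtain ⟨T', hT', hT'Δ, hz'⟩ := hz.exists_extension h hx0 hτ0 hlt
    exact absurd (le_csSup hbdd ⟨hτ0.trans hT'.le, hT'Δ, hz'⟩) (not_le.2 hT')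

end Existence

/-- If the net inflow `λ̃` is piecewise constant and componentwise non-increasing on
`[0, Δ)` and the capacity is constant on `[0, Δ)`, then for every nonnegative initial
condition there is exactly one solution of the zero-delay traffic model on `[0, Δ)`;
moreover its outflow is piecewise constant and componentwise non-increasing. -/
theorem zero_delay_exists_unique [Fintype E] [Nonempty E]
    (R : E → E → ℝ) (lt c : ℝ → E → ℝ) (Δ : ℝ) (x0 : E → ℝ)
    (hΔ : 0 < Δ) (hRnn : ∀ j i, 0 ≤ R j i)
    (hlt_nn : ∀ t ∈ Set.Ico (0:ℝ) Δ, ∀ i, 0 ≤ lt t i)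
    (hc_nn : ∀ t ∈ Set.Ico (0:ℝ) Δ, ∀ i, 0 ≤ c t i)
    (hlt_pwc : ∀ i, PwcOn (fun t => lt t i) (Set.Ico (0:ℝ) Δ))
    (hlt_mono : ∀ i, ∀ s ∈ Set.Ico (0:ℝ) Δ, ∀ t ∈ Set.Ico (0:ℝ) Δ,
      s ≤ t → lt t i ≤ lt s i)
    (hc_const : ∀ i, ∀ s ∈ Set.Ico (0:ℝ) Δ, ∀ t ∈ Set.Ico (0:ℝ) Δ, c s i = c t i)
    (hx0 : ∀ i, 0 ≤ x0 i) :
    (∃ x z : ℝ → E → ℝ, IsSolutionZD R lt c Δ x z ∧ ∀ i, x 0 i = x0 i) ∧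
    (∀ x z x' z' : ℝ → E → ℝ, IsSolutionZD R lt c Δ x z → IsSolutionZD R lt c Δ x' z' →
      (∀ i, x 0 i = x0 i) → (∀ i, x' 0 i = x0 i) →
      ∀ t ∈ Set.Ico (0:ℝ) Δ, ∀ i, x t i = x' t i ∧ z t i = z' t i) ∧
    (∀ x z : ℝ → E → ℝ, IsSolutionZD R lt c Δ x z → (∀ i, x 0 i = x0 i) →
      (∀ i, PwcOn (fun t => z t i) (Set.Ico (0:ℝ) Δ)) ∧
      (∀ i, ∀ s ∈ Set.Ico (0:ℝ) Δ, ∀ t ∈ Set.Ico (0:ℝ) Δ, s ≤ t → z t i ≤ z s i)) := by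
  have h0 : (0 : ℝ) ∈ Set.Ico 0 Δ := ⟨le_rfl, hΔ⟩
  have h : AdmissibleZD R lt c (c 0) Δ :=
    { routing_nonneg := hRnn
      inflow_nonneg := fun t ht i => hlt_nn t ht i
      inflow_antitone := fun i s hs t ht hst => hlt_mono i s hs t ht hst
      inflow_const_right := fun t ht => by
        have hev : ∀ᶠ s in nhdsWithin t (Set.Ici t), ∀ i, s ∈ Set.Ico 0 Δ → lt s i = lt t i :=
          Filter.eventually_all.2 fun i => (hlt_pwc i).eventually_eq_right ht
        obtain ⟨u, hu, H⟩ := mem_nhdsGE_iff_exists_Ico_subset.1 hev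
        exact ⟨u, hu, fun s hs hsΔ => funext fun i => H hs i ⟨ht.1.trans hs.1, hsΔ⟩⟩
      capacity_eq := fun t ht => funext fun i => hc_const i t ht 0 h0
      capacity_nonneg := fun i => hc_nn 0 h0 i }
  refine ⟨?_, fun x z x' z' hs hs' hx hx' t ht i => ?_, fun x z hs _ => ⟨fun i => ?_, ?_⟩⟩
  · obtain ⟨z, hz⟩ := h.exists_solution hx0 hΔ.le
    exact ⟨_, z, hz, fun i => by simp [queueOf]⟩
  · obtain ⟨hxt, hzt⟩ := hs.unique hs' h (funext fun i => (hx i).trans (hx' i).symm) ht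
    exact ⟨congrFun hxt i, congrFun hzt i⟩
  · refine pwcOn_of_antitoneOn (fun s hs' t ht hst => hs.antitoneOn_outflow h hs' ht hst i)
      (hs.finite_image_outflow h (finite_image_of_pwcOn hlt_pwc) i) fun t ht => ?_
    obtain ⟨u, hu, H⟩ := hs.outflow_const_right h ht
    exact ⟨u, hu, fun s hsu hsΔ => congrFun (H s hsu hsΔ) i⟩
  · exact fun i s hs' t ht hst => hs.antitoneOn_outflow h hs' ht hst i
end
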